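/- (Li–Ning) Let G be a bipartite graph with parts of sizes n and m, n ≥ m, and let C be a longest cycle of G with |V(C)| = 2c, where m ≥ c. If m ≤ 2c, then e(G − C) + e(G − C, C) ≤ c(n − 1 − c) + m, where G − C is the graph induced on V(G) \ V(C) and e(G−C, C) counts edges between V(G)\V(C) and V(C). -/

import Mathlib

def hasCycleLength {V : Type*} (G : SimpleGraph V) (l : ℕ) : Prop :=
  ∃ (v : V) (p : G.Walk v v), p.IsCycle ∧ p.length = l

noncomputable section LongestCycle
open scoped Classical

/-- `l` is the vertex list of a path of `G` inside `S` from `a` to `b`. -/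
structure GPath {V : Type*} (G : SimpleGraph V) (S : Finset V) (a b : V) (l : List V) : Prop where
  chain : l.IsChain G.Adj
  nodup : l.Nodup
  sub : ∀ x ∈ l, x ∈ S
  head : l.head? = some a
  last : l.getLast? = some b

namespace GPath
variable {V : Type*} {G : SimpleGraph V} {S T : Finset V} {a b a' b' x : V} {l l' : List V}

theorem single (h : a ∈ S) : GPath G S a a [a] := ⟨by simp, by simp, by simpa, rfl, rfl⟩

theorem mono (h : GPath G S a b l) (hST : ∀ x ∈ l, x ∈ T) : GPath G T a b l :=
  ⟨h.chain, h.nodup, hST, h.head, h.last⟩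

theorem head_mem (h : GPath G S a b l) : a ∈ l := List.mem_of_head? h.head

theorem last_mem (h : GPath G S a b l) : b ∈ l := List.mem_of_getLast? h.last

theorem length_pos (h : GPath G S a b l) : 1 ≤ l.length := List.length_pos_of_mem h.head_mem

theorem reverse (h : GPath G S a b l) : GPath G S b a l.reverse :=
  ⟨by rw [List.isChain_reverse]; exact h.chain.imp fun _ _ h => h.symm,
    by simpa using h.nodup, by simpa using h.sub, by simp [h.last], by simp [h.head]⟩

theorem append (h : GPath G S a b l) (h' : GPath G S a' b' l') (hadj : G.Adj b a')
    (hd : ∀ x ∈ l, x ∉ l') : GPath G S a b' (l ++ l') := by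
  refine ⟨?_, ?_, ?_, by simp [List.head?_append, h.head], by simp [List.getLast?_append, h'.last]⟩
  · rw [List.isChain_append]
    refine ⟨h.chain, h'.chain, ?_⟩
    intro x hx y hy
    rw [h.last] at hx; rw [h'.head] at hy
    simp only [Option.mem_def, Option.some.injEq] at hx hy
    subst hx; subst hy; exact hadj
  · rw [List.nodup_append]
    exact ⟨h.nodup, h'.nodup, fun x hx y hy e => hd x hx (e ▸ hy)⟩
  · intro x hx
    rcases List.mem_append.1 hx with hx | hx
    exacts [h.sub x hx, h'.sub x hx]

theorem cons (h : GPath G S a b l) (hadj : G.Adj x a) (hx : x ∈ S) (hd : x ∉ l) :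
    GPath G S x b (x :: l) :=
  (single hx).append h hadj (by simpa using hd)

theorem concat (h : GPath G S a b l) (hadj : G.Adj b x) (hx : x ∈ S) (hd : x ∉ l) :
    GPath G S a x (l ++ [x]) :=
  h.append (single hx) hadj (by rintro y hy; simp only [List.mem_singleton]; rintro rfl; exact hd hy)

theorem left_of_eq (h : GPath G S a b l) {l₁ l₂ : List V} (e : l = l₁ ++ l₂)
    (h₁ : l₁.getLast? = some x) : GPath G S a x l₁ := by
  subst e
  refine ⟨(List.isChain_append.1 h.chain).1, (List.nodup_append.1 h.nodup).1,
    fun y hy => h.sub y (by simp [hy]), ?_, h₁⟩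
  have := h.head
  cases l₁ with
  | nil => simp at h₁
  | cons y l₁ => simpa using this

theorem right_of_eq (h : GPath G S a b l) {l₁ l₂ : List V} (e : l = l₁ ++ l₂)
    (h₂ : l₂.head? = some x) : GPath G S x b l₂ := by
  subst e
  refine ⟨(List.isChain_append.1 h.chain).2.1, (List.nodup_append.1 h.nodup).2.1,
    fun y hy => h.sub y (by simp [hy]), h₂, ?_⟩
  have := h.last
  rw [List.getLast?_append] at this
  cases l₂ with
  | nil => simp at h₂
  | cons y l₂ => 
    rw [List.getLast?_eq_some_getLast (by simp)] at this ⊢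
    simpa using this

/-- The number of vertices of colour `κ` on a path is determined by its length and the colours
of its ends. -/
theorem two_mul_countP {col : V → Bool} (bip : ∀ u v, G.Adj u v → col u ≠ col v)
    (h : GPath G S a b l) (κ : Bool) :
    2 * l.countP (fun v => col v == κ) + 1 =
      l.length + (if col a = κ then 1 else 0) + (if col b = κ then 1 else 0) := by
  induction l generalizing a with
  | nil => have := h.head; simp at this
  | cons y l ih =>
    have hy : y = a := by simpa using h.head
    subst hy
    cases l with
    | nil =>
      have hb : y = b := by simpa using h.last
      subst hb
      by_cases hc : col y = κ <;> simp [hc]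
    | cons w l =>
      have h' : GPath G S w b (w :: l) := h.right_of_eq (l₁ := [y]) rfl rfl
      have := ih h'
      have hadj : G.Adj y w := by
        have := h.chain; rw [List.isChain_cons_cons] at this; exact this.1
      have hc := bip _ _ hadj
      rw [List.countP_cons, List.length_cons]
      by_cases h1 : col y = κ
      · have h2 : col w ≠ κ := fun e => hc (h1.trans e.symm)
        simp only [h1, h2, beq_self_eq_true, if_true, if_false] at this ⊢
        omega
      · have h2 : col w = κ := by
          cases hh : col y <;> cases hw : col w <;> cases κ <;> simp_all
        have h3 : (col y == κ) = false := by simpa using h1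
        simp only [h1, h2, h3, if_true, if_false] at this ⊢
        simp
        omega

theorem take_getElem (h : GPath G S a b l) {i : ℕ} (hi : i < l.length) :
    GPath G S a l[i] (l.take (i + 1)) := by
  refine h.left_of_eq (List.take_append_drop (i + 1) l).symm ?_
  rw [List.getLast?_eq_getElem?]
  have : min (i + 1) l.length - 1 = i := by omega
  simp [this, hi]

theorem drop_getElem (h : GPath G S a b l) {i : ℕ} (hi : i < l.length) :
    GPath G S l[i] b (l.drop i) := by
  refine h.right_of_eq (List.take_append_drop i l).symm ?_
  simp [List.head?_drop, hi]

theorem adj_getElem (h : GPath G S a b l) {i : ℕ} (hi : i + 1 < l.length) :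
    G.Adj l[i] l[i + 1] := List.isChain_iff_getElem.1 h.chain i hi

theorem exists_getElem (_h : GPath G S a b l) (hx : x ∈ l) : ∃ i, ∃ hi : i < l.length, l[i] = x :=
  List.mem_iff_getElem.1 hx

theorem getElem_zero (h : GPath G S a b l) : l[0]'(h.length_pos) = a := by
  have := h.head
  rw [List.head?_eq_getElem?, List.getElem?_eq_getElem h.length_pos] at this
  simpa using this

end GPath

/-- A two-coloured graph `G` (the colour classes are the fibres of `col`) with a longest
cycle on the `2 * c` vertices `z i`, which is traversed periodically by `z`. -/
structure CycleSetup {V : Type*} (G : SimpleGraph V) (col : V → Bool) (c : ℕ) (z : ℤ → V) :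
    Prop where
  bip : ∀ u v, G.Adj u v → col u ≠ col v
  two_le : 2 ≤ c
  adj : ∀ i, G.Adj (z i) (z (i + 1))
  inj : ∀ i j, z i = z j ↔ (2 * c : ℤ) ∣ i - j
  col_even : ∀ i, col (z (2 * i)) = true
  max : ∀ (l : List V) (a b : V), l.IsChain G.Adj → l.Nodup → l.head? = some a → l.getLast? = some b →
    G.Adj b a → 3 ≤ l.length → l.length ≤ 2 * c

namespace CycleSetup
variable {V : Type*} {G : SimpleGraph V} {col : V → Bool} {c : ℕ} {z : ℤ → V}

theorem col_odd (h : CycleSetup G col c z) (i : ℤ) : col (z (2 * i + 1)) = false := by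
  have h1 := h.bip _ _ (h.adj (2 * i))
  rw [h.col_even] at h1
  cases hh : col (z (2 * i + 1)) <;> simp_all

theorem swap (h : CycleSetup G col c z) : CycleSetup G (fun v => !col v) c (fun i => z (i + 1)) where
  bip u v huv := by have := h.bip u v huv; simpa using this
  two_le := h.two_le
  adj i := h.adj (i + 1)
  inj i j := by rw [h.inj]; simp
  col_even i := by simp [h.col_odd]
  max := h.max

theorem max' (h : CycleSetup G col c z) {S : Finset V} {a b : V} {l : List V}
    (hl : GPath G S a b l) (hadj : G.Adj b a) (h3 : 3 ≤ l.length) : l.length ≤ 2 * c :=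
  h.max l a b hl.chain hl.nodup hl.head hl.last hadj h3

end CycleSetup

/-- The list `z p, z (p + 1), …` of `n` consecutive values. -/
def arcList {V : Type*} (z : ℤ → V) (p : ℤ) (n : ℕ) : List V :=
  (List.range n).map fun i : ℕ => z (p + i)

theorem mem_arcList {V : Type*} {z : ℤ → V} {p : ℤ} {n : ℕ} {x : V} :
    x ∈ arcList z p n ↔ ∃ i : ℕ, i < n ∧ z (p + i) = x := by
  simp [arcList]

@[simp] theorem length_arcList {V : Type*} {z : ℤ → V} {p : ℤ} {n : ℕ} :
    (arcList z p n).length = n := by simp [arcList]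

namespace CycleSetup
variable {V : Type*} [Fintype V] {G : SimpleGraph V} {col : V → Bool} {c : ℕ} {z : ℤ → V}

theorem gpath_arcList (h : CycleSetup G col c z) (p : ℤ) (n : ℕ) (hn : n < 2 * c) :
    GPath G Finset.univ (z p) (z (p + n)) (arcList z p (n + 1)) := by
  refine ⟨?_, ?_, by simp, by simp [arcList, List.range_succ_eq_map], by
    simp [arcList, List.range_succ]⟩
  · rw [List.isChain_iff_getElem]
    intro i hi
    simp only [arcList, List.getElem_map, List.getElem_range]
    have := h.adj (p + i)
    push_cast
    rwa [← add_assoc]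
  · refine List.Nodup.map_on ?_ List.nodup_range
    intro i hi j hj e
    rw [h.inj] at e
    simp only [List.mem_range] at hi hj
    obtain ⟨k, hk⟩ := e
    have h1 : (2 * c : ℤ) * k < 2 * c := by rw [← hk]; omega
    have h2 : -(2 * c : ℤ) < (2 * c : ℤ) * k := by rw [← hk]; omega
    have hc : (0 : ℤ) < 2 * c := by have := h.two_le; omega
    have : k = 0 := by
      have : k < 1 := by nlinarith
      have : -1 < k := by nlinarith
      omega
    subst this; omega

variable {W : Finset V} {a b : V} {l : List V}

theorem exists_shift (h : CycleSetup G col c z) {p q : ℤ} (hpq : z p ≠ z q) :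
    ∃ k : ℤ, z (q + 2 * c * k) = z q ∧ p < q + 2 * c * k ∧ q + 2 * c * k < p + 2 * c := by
  have hc : (0 : ℤ) < 2 * c := by have := h.two_le; omega
  refine ⟨-((q - p) / (2 * c)), (h.inj _ _).2 ⟨-((q - p) / (2 * c)), by ring⟩, ?_, ?_⟩
  · have h1 := Int.emod_nonneg (q - p) hc.ne'
    have h2 := Int.emod_add_mul_ediv (q - p) (2 * c)
    have h3 : (q - p) % (2 * c) ≠ 0 := fun e => hpq
      ((h.inj _ _).2 (by rw [← dvd_neg, neg_sub]; exact Int.dvd_of_emod_eq_zero e))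
    have : q + 2 * c * -((q - p) / (2 * c)) = p + (q - p) % (2 * c) := by
      rw [mul_neg]; linarith
    omega
  · have h1 := Int.emod_lt_of_pos (q - p) hc
    have h2 := Int.emod_add_mul_ediv (q - p) (2 * c)
    have : q + 2 * c * -((q - p) / (2 * c)) = p + (q - p) % (2 * c) := by
      rw [mul_neg]; linarith
    omega

theorem length_add_one_le_sub (h : CycleSetup G col c z) (hW : ∀ w ∈ W, ∀ i, w ≠ z i)
    (hl : GPath G W a b l) {p q : ℤ} (ha : G.Adj a (z p)) (hb : G.Adj b (z q)) (hpq : p < q)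
    (hq : q < p + 2 * c) : (l.length : ℤ) + 1 ≤ q - p := by
  obtain ⟨n, hn⟩ : ∃ n : ℕ, p + 2 * c = q + n := ⟨(p + 2 * c - q).toNat, by omega⟩
  have h1 := h.gpath_arcList q n (by omega)
  have h2 : z (q + n) = z p := by rw [← hn, h.inj]; exact ⟨1, by ring⟩
  rw [h2] at h1
  have h3 := (hl.mono (T := Finset.univ) (by simp)).append h1 hb (by
    intro x hx hx'
    obtain ⟨i, -, e⟩ := mem_arcList.1 hx'
    exact hW x (hl.sub x hx) _ e.symm)
  have := hl.length_pos
  have h4 := h.max' h3 ha.symm (by simp; omega)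
  simp at h4
  omega

/-- A path outside a longest cycle joining two distinct vertices of the cycle is no longer than
either arc between them. -/
theorem length_add_one_le_abs (h : CycleSetup G col c z) (hW : ∀ w ∈ W, ∀ i, w ≠ z i)
    (hl : GPath G W a b l) {p q : ℤ} (ha : G.Adj a (z p)) (hb : G.Adj b (z q))
    (hpq : z p ≠ z q) : (l.length : ℤ) + 1 ≤ |q - p| := by
  have hc : (0 : ℤ) < 2 * c := by have := h.two_le; omega
  wlog hlt : p < q generalizing p q a b l
  · have hne : p ≠ q := fun e => hpq (e ▸ rfl)
    have := this hl.reverse hb ha hpq.symm (by omega)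
    rw [abs_sub_comm]; simpa using this
  rw [abs_of_pos (by omega)]
  obtain ⟨k, hk, h1, h2⟩ := h.exists_shift hpq
  have h3 := h.length_add_one_le_sub hW hl ha (hk ▸ hb) h1 h2
  by_cases hk0 : k ≤ 0
  · have : 2 * c * k ≤ 0 := by nlinarith
    omega
  · have : 2 * c * k ≥ 2 * c := by nlinarith
    omega

theorem length_add_one_le (h : CycleSetup G col c z) (hW : ∀ w ∈ W, ∀ i, w ≠ z i)
    (hl : GPath G W a b l) {p : ℤ} (ha : G.Adj a (z p)) (hb : G.Adj b (z p))
    (h2 : 2 ≤ l.length) : l.length + 1 ≤ 2 * c := by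
  have h1 := (hl.mono (T := Finset.univ) (by simp)).concat hb (by simp)
    (fun hx => hW _ (hl.sub _ hx) _ rfl)
  have h4 := h.max' h1 ha.symm (by simp; omega)
  simpa using h4

/-- Two disjoint paths outside a longest cycle whose attachment points cross. -/
theorem crossing (h : CycleSetup G col c z) (hW : ∀ w ∈ W, ∀ i, w ≠ z i)
    {a' b' : V} {l' : List V} (hl : GPath G W a b l) (hl' : GPath G W a' b' l')
    (hd : ∀ x ∈ l, x ∉ l') {i₀ j₀ i₁ j₁ : ℤ} (ha : G.Adj a (z j₀)) (hb : G.Adj b (z j₁))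
    (ha' : G.Adj a' (z i₀)) (hb' : G.Adj b' (z i₁)) (h₁ : i₀ < j₀) (h₂ : j₀ < i₁) (h₃ : i₁ < j₁)
    (h₄ : j₁ < i₀ + 2 * c) : (l.length : ℤ) + l'.length + 2 ≤ (j₀ - i₀) + (j₁ - i₁) := by
  obtain ⟨n, hn⟩ : ∃ n : ℕ, i₁ = j₀ + n := ⟨(i₁ - j₀).toNat, by omega⟩
  obtain ⟨m, hm⟩ : ∃ m : ℕ, i₀ + 2 * c = j₁ + m := ⟨(i₀ + 2 * c - j₁).toNat, by omega⟩
  have A1 := h.gpath_arcList j₀ n (by omega)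
  have A2 := (h.gpath_arcList j₁ m (by omega)).reverse
  have e2 : z (j₁ + m) = z i₀ := by rw [← hm, h.inj]; exact ⟨1, by ring⟩
  rw [e2] at A2
  rw [← hn] at A1
  have hnot : ∀ x ∈ W, ∀ p n, x ∉ arcList z p n := by
    intro x hx p n hx'
    obtain ⟨i, -, e⟩ := mem_arcList.1 hx'
    exact hW x hx _ e.symm
  have P1 := A1.append ((hl'.mono (T := Finset.univ) (by simp)).reverse) hb'.symm (by
    intro x hx hx'
    rw [List.mem_reverse] at hx'
    exact hnot x (hl'.sub x hx') _ _ hx)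
  have P2 := A2.append ((hl.mono (T := Finset.univ) (by simp)).reverse) hb.symm (by
    intro x hx hx'
    rw [List.mem_reverse] at hx hx'
    exact hnot x (hl.sub x hx') _ _ hx)
  have P3 := P1.append P2 ha' (by
    intro x hx hx'
    simp only [List.mem_append, List.mem_reverse] at hx hx'
    rcases hx with hx | hx <;> rcases hx' with hx' | hx'
    · obtain ⟨i, hi, rfl⟩ := mem_arcList.1 hx
      obtain ⟨j, hj, e⟩ := mem_arcList.1 hx'
      rw [h.inj] at e
      have hc : (0 : ℤ) < 2 * c := by have := h.two_le; omega
      have hpos : 0 < j₁ + j - (j₀ + i) := by omega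
      have := Int.le_of_dvd hpos e
      omega
    · exact hnot x (hl.sub x hx') _ _ hx
    · exact hnot x (hl'.sub x hx) _ _ hx'
    · exact hd x hx' hx)
  have := hl.length_pos
  have h4 := h.max' P3 ha (by simp; omega)
  simp at h4
  omega

end CycleSetup

section ZModSets
variable {c : ℕ} [NeZero c]

theorem ZMod.eq_univ_of_add_one_mem {S : Finset (ZMod c)} (hS : S.Nonempty)
    (h : ∀ x ∈ S, x + 1 ∈ S) : S = Finset.univ := by
  obtain ⟨s, hs⟩ := hS
  have h1 : ∀ n : ℕ, s + n ∈ S := by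
    intro n
    induction n with
    | zero => simpa using hs
    | succ n ih => have := h _ ih; push_cast; rwa [← add_assoc]
  refine Finset.eq_univ_of_forall fun x => ?_
  have := h1 (x - s).val
  rwa [ZMod.natCast_zmod_val, add_sub_cancel] at this

/-- A weak form of the Cauchy–Davenport bound, for the sum of a set and an interval. -/
theorem ZMod.min_le_card_image_add_range {S : Finset (ZMod c)} (hS : S.Nonempty) (n : ℕ) :
    min c (S.card + n) ≤
      ((S ×ˢ Finset.range (n + 1)).image fun q => q.1 + (q.2 : ZMod c)).card := by
  induction n with
  | zero =>
    refine (min_le_right _ _).trans (Finset.card_le_card fun x hx => ?_)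
    exact Finset.mem_image.2 ⟨(x, 0), by simp [hx], by simp⟩
  | succ n ih =>
    set F := (S ×ˢ Finset.range (n + 1)).image fun q => q.1 + (q.2 : ZMod c) with hF
    set F' := (S ×ˢ Finset.range (n + 1 + 1)).image fun q => q.1 + (q.2 : ZMod c) with hF'
    have hsub : F ⊆ F' := Finset.image_subset_image
      (Finset.product_subset_product_right (Finset.range_mono (by omega)))
    by_cases hu : F = Finset.univ
    · have := Finset.card_le_card hsub
      rw [hu, Finset.card_univ, ZMod.card] at this
      omega
    · have hne : F.Nonempty := by
        obtain ⟨s, hs⟩ := hS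
        exact ⟨s, Finset.mem_image.2 ⟨(s, 0), by simp [hs], by simp⟩⟩
      have : ∃ x ∈ F, x + 1 ∉ F := by
        by_contra! hcon
        exact hu (ZMod.eq_univ_of_add_one_mem hne hcon)
      obtain ⟨x, hx, hx'⟩ := this
      have hx1 : x + 1 ∈ F' := by
        obtain ⟨⟨s, k⟩, hq, rfl⟩ := Finset.mem_image.1 hx
        simp only [Finset.mem_product, Finset.mem_range] at hq
        refine Finset.mem_image.2 ⟨(s, k + 1), ?_, by push_cast; ring⟩
        simp only [Finset.mem_product, Finset.mem_range]
        exact ⟨hq.1, by omega⟩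
      have := Finset.card_lt_card (Finset.ssubset_iff_subset_ne.2 ⟨hsub, fun e => hx' (e ▸ hx1)⟩)
      omega

/-- If `T` avoids the translates of `S` by `n` consecutive integers then both sets are small. -/
theorem ZMod.card_add_card_add_le {S T : Finset (ZMod c)} (hS : S.Nonempty) (hT : T.Nonempty)
    {n : ℕ} (hn : 1 ≤ n) {lo : ℤ}
    (h : ∀ s ∈ S, ∀ t ∈ T, ∀ k : ℤ, lo ≤ k → k < lo + n → t ≠ s + k) :
    S.card + T.card + n ≤ c + 1 := by
  obtain ⟨n, rfl⟩ : ∃ m, n = m + 1 := ⟨n - 1, by omega⟩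
  have h1 := ZMod.min_le_card_image_add_range hS n
  set F := (S ×ˢ Finset.range (n + 1)).image fun q => q.1 + (q.2 : ZMod c)
  have hd : Disjoint F (T.image fun t => t - (lo : ZMod c)) := by
    rw [Finset.disjoint_left]
    intro x hx hx'
    obtain ⟨⟨s, k⟩, hq, rfl⟩ := Finset.mem_image.1 hx
    obtain ⟨t, ht, e⟩ := Finset.mem_image.1 hx'
    simp only [Finset.mem_product, Finset.mem_range] at hq
    refine h s hq.1 t ht (lo + k) (by omega) (by push_cast; omega) ?_
    push_cast
    rw [sub_eq_iff_eq_add] at e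
    rw [e]; ring
  have h2 := Finset.card_le_univ (F ∪ T.image fun t => t - (lo : ZMod c))
  rw [Finset.card_union_of_disjoint hd, Finset.card_image_of_injective _ (sub_left_injective),
    ZMod.card] at h2
  have := hT.card_pos
  omega

/-- Integers in a window of length `c` represent distinct residues. -/
theorem ZMod.card_add_card_le_of_window {A : Finset (ZMod c)} {J : Finset ℤ} {lo : ℤ}
    (hJ : ∀ k ∈ J, lo ≤ k ∧ k < lo + c) (h : ∀ k ∈ J, (k : ZMod c) ∉ A) :
    A.card + J.card ≤ c := by
  have hinj : Set.InjOn (fun k : ℤ => (k : ZMod c)) J := by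
    intro i hi j hj e
    simp only at e
    rw [ZMod.intCast_eq_intCast_iff_dvd_sub] at e
    have h1 := hJ i hi; have h2 := hJ j hj
    by_contra hne
    rcases lt_or_gt_of_ne hne with hlt | hlt
    · have := Int.le_of_dvd (by omega) e; omega
    · have := Int.le_of_dvd (by omega) ((dvd_neg.2 e)); omega
  have hd : Disjoint A (J.image fun k : ℤ => (k : ZMod c)) := by
    rw [Finset.disjoint_right]
    intro x hx
    obtain ⟨k, hk, rfl⟩ := Finset.mem_image.1 hx
    exact h k hk
  have h2 := Finset.card_le_univ (A ∪ J.image fun k : ℤ => (k : ZMod c))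
  rwa [Finset.card_union_of_disjoint hd, Finset.card_image_of_injOn hinj, ZMod.card] at h2

theorem ZMod.card_add_card_add_two_mul_le {A₀ A₁ : Finset (ZMod c)} {r : ℕ} (hr : 1 ≤ r)
    (h₀ : 2 ≤ A₀.card) (h₁ : 2 ≤ A₁.card) (hrc : 2 * r + 2 ≤ c)
    (h : ∀ a₀ ∈ A₀, ∀ a₁ ∈ A₁, a₀ ≠ a₁ → ∀ k : ℤ, |k| ≤ r → a₁ ≠ a₀ + k) :
    A₀.card + A₁.card + 2 * r ≤ c + 2 := by
  have n₀ : A₀.Nonempty := Finset.card_pos.1 (by omega)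
  have n₁ : A₁.Nonempty := Finset.card_pos.1 (by omega)
  by_cases hb : ∃ b, b ∈ A₀ ∧ b ∈ A₁
  · obtain ⟨b, hb₀, hb₁⟩ := hb
    have hS : (A₁.erase b).Nonempty := Finset.card_pos.1 (by rw [Finset.card_erase_of_mem hb₁]; omega)
    -- the translates by `1, …, r` of `A₁ \ {b}`
    have h1 := ZMod.min_le_card_image_add_range hS (r - 1)
    set F := (A₁.erase b ×ˢ Finset.range (r - 1 + 1)).image fun q => q.1 + (q.2 : ZMod c)
      with hF
    have memF : ∀ x ∈ F, ∃ a ∈ A₁, a ≠ b ∧ ∃ k : ℤ, 1 ≤ k ∧ k ≤ r ∧ x + 1 = a + k := by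
      intro x hx
      obtain ⟨⟨s, k⟩, hq, rfl⟩ := Finset.mem_image.1 hx
      simp only [Finset.mem_product, Finset.mem_range, Finset.mem_erase] at hq
      exact ⟨s, hq.1.2, hq.1.1, k + 1, by omega, by omega, by push_cast; ring⟩
    have hd : Disjoint (F.image fun x => x + 1) (A₀.erase b) := by
      rw [Finset.disjoint_left]
      intro x hx hx'
      obtain ⟨y, hy, rfl⟩ := Finset.mem_image.1 hx
      obtain ⟨a, ha, hab, k, hk1, hk2, e⟩ := memF y hy
      rw [e, Finset.mem_erase] at hx'
      refine h _ hx'.2 a ha ?_ (-k) (by rw [abs_neg, abs_of_nonneg (by omega)]; omega)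
        (by push_cast; ring)
      intro e2
      have e3 : ((k : ℤ) : ZMod c) = ((0 : ℤ) : ZMod c) := by
        push_cast; exact left_eq_add.1 e2.symm
      rw [ZMod.intCast_eq_intCast_iff_dvd_sub] at e3
      have := Int.le_of_dvd (by omega) ((dvd_neg.2 e3)); omega
    have hw := ZMod.card_add_card_le_of_window (c := c)
      (A := F.image (fun x => x + 1) ∪ A₀.erase b)
      (J := Finset.Ico (b.cast : ℤ) (b.cast + r + 1)) (lo := b.cast)
      (by intro k hk; rw [Finset.mem_Ico] at hk; omega)
      (by
        intro k hk
        rw [Finset.mem_Ico] at hk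
        have hbk : (k : ZMod c) = b + ((k - b.cast : ℤ) : ZMod c) := by
          push_cast; ring
        rw [Finset.mem_union, not_or]
        constructor
        · intro hx
          obtain ⟨y, hy, e0⟩ := Finset.mem_image.1 hx
          obtain ⟨a, ha, hab, j, hj1, hj2, e⟩ := memF y hy
          rw [e, hbk] at e0
          refine h b hb₀ a ha (Ne.symm hab) (k - b.cast - j) (by rw [abs_le]; omega) ?_
          push_cast at e0 ⊢
          linear_combination e0
        · intro hx
          rw [Finset.mem_erase] at hx
          refine h _ hx.2 b hb₁ hx.1 (-(k - b.cast)) (by rw [abs_le]; omega) ?_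
          rw [hbk]; push_cast; ring)
    rw [Finset.card_union_of_disjoint hd, Finset.card_image_of_injective _ (add_left_injective 1),
      Finset.card_erase_of_mem hb₀, Int.card_Ico] at hw
    rw [Finset.card_erase_of_mem hb₁] at h1
    omega
  · push Not at hb
    have := ZMod.card_add_card_add_le (c := c) n₀ n₁ (n := 2 * r + 1) (by omega) (lo := -r)
      (fun s hs t ht k h1 h2 => h s hs t ht (fun e => hb s hs (e ▸ ht)) k
        (by rw [abs_le]; push_cast at h2; omega))
    omega

private theorem ZMod.no_coupling_of_min {A₀ A₁ D₀ D₁ : Finset (ZMod c)} {r s f : ℕ} {a d : ZMod c}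
    (ha : a ∈ A₀) (hd : d ∈ D₀) (had : a = d + f)
    (hmin : ∀ a ∈ A₀ ∪ A₁, ∀ d ∈ D₀ ∪ D₁, ∀ k : ℕ, k < f → a ≠ d + k ∧ d ≠ a + 1 + k)
    (hA : ∀ a₀ ∈ A₀, ∀ a₁ ∈ A₁, a₀ ≠ a₁ → ∀ k : ℤ, |k| ≤ r → a₁ ≠ a₀ + k)
    (hD : ∀ d₀ ∈ D₀, ∀ d₁ ∈ D₁, d₀ ≠ d₁ → ∀ k : ℤ, |k| ≤ s → d₁ ≠ d₀ + k)
    (hF : ∀ a₀ ∈ A₀, ∀ a₁ ∈ A₁, ∀ d₀ ∈ D₀, ∀ d₁ ∈ D₁, a₀ ≠ a₁ → d₀ ≠ d₁ → ∀ i j : ℕ,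
      a₀ = d₀ + i → a₁ = d₁ + j → r + s + 1 ≤ i + j)
    (hp₀ : c + 2 ≤ A₀.card + D₀.card + r + s) (hp₁ : c + 2 ≤ A₁.card + D₁.card + r + s)
    (hA₁ : 2 ≤ A₁.card) (hD₁ : 2 ≤ D₁.card) : False := by
  have hf : f = 0 ∨ 2 * f + 1 ≤ r + s := by
    rcases Nat.eq_zero_or_pos f with h0 | h0
    · exact Or.inl h0
    right
    have := ZMod.card_add_card_add_le (S := D₀) (T := A₀) ⟨d, hd⟩ ⟨a, ha⟩ (n := 2 * f) (by omega)
      (lo := -f) (by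
        intro d hd a ha k h1 h2 e
        push_cast at h2
        have hm := hmin a (by simp [ha]) d (by simp [hd])
        rcases lt_or_ge k 0 with hk | hk
        · refine (hm (-k - 1).toNat (by omega)).2 ?_
          have : (((-k - 1).toNat : ℕ) : ZMod c) = ((-k - 1 : ℤ) : ZMod c) := by
            rw [← Int.cast_natCast, Int.toNat_of_nonneg (by omega)]
          rw [this, e]; push_cast; ring
        · refine (hm k.toNat (by omega)).1 ?_
          have : ((k.toNat : ℕ) : ZMod c) = (k : ZMod c) := by
            rw [← Int.cast_natCast, Int.toNat_of_nonneg (by omega)]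
          rw [this, e])
    omega
  have cA := Finset.card_erase_add_one (s := A₁) (a := a)
  have cD := Finset.card_erase_add_one (s := D₁) (a := d)
  have cA' : A₁.card ≤ (A₁.erase a).card + 1 := by
    have := Finset.pred_card_le_card_erase (s := A₁) (a := a); omega
  have cD' : D₁.card ≤ (D₁.erase d).card + 1 := by
    have := Finset.pred_card_le_card_erase (s := D₁) (a := d); omega
  have nA : (A₁.erase a).Nonempty := Finset.card_pos.1 (by omega)
  have nD : (D₁.erase d).Nonempty := Finset.card_pos.1 (by omega)
  -- the differences in `[-f, r + s - f]` do not occur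
  have key : ∀ a₁ ∈ A₁.erase a, ∀ d₁ ∈ D₁.erase d, ∀ k : ℤ, -f ≤ k → k ≤ r + s - f →
      a₁ ≠ d₁ + k := by
    intro a₁ ha₁ d₁ hd₁ k h1 h2 e
    rw [Finset.mem_erase] at ha₁ hd₁
    have hm := hmin a₁ (by simp [ha₁.2]) d₁ (by simp [hd₁.2])
    rcases lt_or_ge k 0 with hk | hk
    · refine (hm (-k - 1).toNat (by omega)).2 ?_
      have : (((-k - 1).toNat : ℕ) : ZMod c) = ((-k - 1 : ℤ) : ZMod c) := by
        rw [← Int.cast_natCast, Int.toNat_of_nonneg (by omega)]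
      rw [this, e]; push_cast; ring
    · have := hF a ha a₁ ha₁.2 d hd d₁ hd₁.2 (Ne.symm ha₁.1) (Ne.symm hd₁.1) f k.toNat had (by
        have : ((k.toNat : ℕ) : ZMod c) = (k : ZMod c) := by
          rw [← Int.cast_natCast, Int.toNat_of_nonneg (by omega)]
        rw [this, e])
      omega
  rcases le_total s r with hsr | hsr
  · obtain ⟨k, hk1, hk2, hk3, hk4⟩ : ∃ k : ℤ, 2 * f - r ≤ k ∧ k ≤ 2 * f - s ∧ -s ≤ k ∧ k ≤ s :=
      ⟨max (2 * f - r) (-s), by omega, by omega, by omega, by omega⟩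
    have hnot : d + (k : ZMod c) ∉ D₁.erase d := by
      intro hx
      rw [Finset.mem_erase] at hx
      exact hD d hd _ hx.2 (Ne.symm hx.1) k (by rw [abs_le]; omega) rfl
    have := ZMod.card_add_card_add_le (S := A₁.erase a) (T := insert (d + (k : ZMod c)) (D₁.erase d))
      nA ⟨_, Finset.mem_insert_self _ _⟩ (n := r + s + 1) (by omega) (lo := -(r + s - f)) (by
        intro a₁ ha₁ t ht j h1 h2 e
        push_cast at h2
        rw [Finset.mem_insert] at ht
        rcases ht with rfl | ht
        · rw [Finset.mem_erase] at ha₁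
          refine hA a ha a₁ ha₁.2 (Ne.symm ha₁.1) (k - f - j) (by rw [abs_le]; omega) ?_
          push_cast
          linear_combination - had - e
        · refine key a₁ ha₁ t ht (-j) (by omega) (by omega) ?_
          push_cast
          linear_combination -e)
    rw [Finset.card_insert_of_notMem hnot] at this
    omega
  · obtain ⟨k, hk1, hk2, hk3, hk4⟩ : ∃ k : ℤ, r - 2 * f ≤ k ∧ k ≤ s - 2 * f ∧ -r ≤ k ∧ k ≤ r :=
      ⟨max (r - 2 * f) (-r), by omega, by omega, by omega, by omega⟩
    have hnot : a + (k : ZMod c) ∉ A₁.erase a := by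
      intro hx
      rw [Finset.mem_erase] at hx
      exact hA a ha _ hx.2 (Ne.symm hx.1) k (by rw [abs_le]; omega) rfl
    have := ZMod.card_add_card_add_le (S := D₁.erase d) (T := insert (a + (k : ZMod c)) (A₁.erase a))
      nD ⟨_, Finset.mem_insert_self _ _⟩ (n := r + s + 1) (by omega) (lo := -f) (by
        intro d₁ hd₁ t ht j h1 h2 e
        push_cast at h2
        rw [Finset.mem_insert] at ht
        rcases ht with rfl | ht
        · rw [Finset.mem_erase] at hd₁
          refine hD d hd d₁ hd₁.2 (Ne.symm hd₁.1) (k + f - j) (by rw [abs_le]; omega) ?_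
          push_cast
          linear_combination had - e
        · exact key t ht d₁ hd₁ j (by omega) (by omega) e)
    rw [Finset.card_insert_of_notMem hnot] at this
    omega

/-- Two families of attachment sets, each spread out, cannot both be large when all pairs of
chords between them are far apart. -/
theorem ZMod.no_coupling {A₀ A₁ D₀ D₁ : Finset (ZMod c)} {r s : ℕ}
    (hA : ∀ a₀ ∈ A₀, ∀ a₁ ∈ A₁, a₀ ≠ a₁ → ∀ k : ℤ, |k| ≤ r → a₁ ≠ a₀ + k)
    (hD : ∀ d₀ ∈ D₀, ∀ d₁ ∈ D₁, d₀ ≠ d₁ → ∀ k : ℤ, |k| ≤ s → d₁ ≠ d₀ + k)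
    (hF : ∀ a₀ ∈ A₀, ∀ a₁ ∈ A₁, ∀ d₀ d₁, (d₀ ∈ D₀ ∧ d₁ ∈ D₁ ∨ d₀ ∈ D₁ ∧ d₁ ∈ D₀) →
      a₀ ≠ a₁ → d₀ ≠ d₁ → ∀ i j : ℕ, a₀ = d₀ + i → a₁ = d₁ + j → r + s + 1 ≤ i + j)
    (hB : ∀ a₀ ∈ A₀, ∀ a₁ ∈ A₁, ∀ d₀ d₁, (d₀ ∈ D₀ ∧ d₁ ∈ D₁ ∨ d₀ ∈ D₁ ∧ d₁ ∈ D₀) →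
      a₀ ≠ a₁ → d₀ ≠ d₁ → ∀ i j : ℕ, d₀ = a₀ + 1 + i → d₁ = a₁ + 1 + j → r + s + 1 ≤ i + j)
    (h₀₀ : c + 2 ≤ A₀.card + D₀.card + r + s) (h₀₁ : c + 2 ≤ A₀.card + D₁.card + r + s)
    (h₁₀ : c + 2 ≤ A₁.card + D₀.card + r + s) (h₁₁ : c + 2 ≤ A₁.card + D₁.card + r + s)
    (hA₀ : 2 ≤ A₀.card) (hA₁ : 2 ≤ A₁.card) (hD₀ : 2 ≤ D₀.card) (hD₁ : 2 ≤ D₁.card) : False := by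
  have hex : ∃ k : ℕ, ∃ a ∈ A₀ ∪ A₁, ∃ d ∈ D₀ ∪ D₁, a = d + k ∨ d = a + 1 + k := by
    obtain ⟨a, ha⟩ := Finset.card_pos.1 (show 0 < A₀.card by omega)
    obtain ⟨d, hd⟩ := Finset.card_pos.1 (show 0 < D₀.card by omega)
    exact ⟨(a - d).val, a, by simp [ha], d, by simp [hd], Or.inl (by simp)⟩
  have hmin : ∀ a ∈ A₀ ∪ A₁, ∀ d ∈ D₀ ∪ D₁, ∀ k : ℕ, k < Nat.find hex →
      a ≠ d + k ∧ d ≠ a + 1 + k := by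
    intro a ha d hd k hk
    exact ⟨fun e => Nat.find_min hex hk ⟨a, ha, d, hd, Or.inl e⟩,
      fun e => Nat.find_min hex hk ⟨a, ha, d, hd, Or.inr e⟩⟩
  have hA' : ∀ a₀ ∈ A₁, ∀ a₁ ∈ A₀, a₀ ≠ a₁ → ∀ k : ℤ, |k| ≤ r → a₁ ≠ a₀ + k :=
    fun a₀ h₀ a₁ h₁ hne k hk e => hA a₁ h₁ a₀ h₀ hne.symm (-k) (by rwa [abs_neg])
      (by rw [e]; push_cast; ring)
  have hD' : ∀ d₀ ∈ D₁, ∀ d₁ ∈ D₀, d₀ ≠ d₁ → ∀ k : ℤ, |k| ≤ s → d₁ ≠ d₀ + k :=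
    fun a₀ h₀ a₁ h₁ hne k hk e => hD a₁ h₁ a₀ h₀ hne.symm (-k) (by rwa [abs_neg])
      (by rw [e]; push_cast; ring)
  obtain ⟨a, ha, d, hd, he⟩ := Nat.find_spec hex
  rw [Finset.mem_union] at ha hd
  set f := Nat.find hex
  rcases he with he | he
  · rcases ha with ha | ha <;> rcases hd with hd | hd
    · exact ZMod.no_coupling_of_min ha hd he hmin hA hD
        (fun a₀ i₁ a₁ i₂ d₀ i₃ d₁ i₄ n₁ n₂ i j e₁ e₂ =>
          hF a₀ i₁ a₁ i₂ d₀ d₁ (Or.inl ⟨i₃, i₄⟩) n₁ n₂ i j e₁ e₂) h₀₀ h₁₁ hA₁ hD₁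
    · exact ZMod.no_coupling_of_min ha hd he (by rwa [Finset.union_comm D₁]) hA hD'
        (fun a₀ i₁ a₁ i₂ d₀ i₃ d₁ i₄ n₁ n₂ i j e₁ e₂ =>
          hF a₀ i₁ a₁ i₂ d₀ d₁ (Or.inr ⟨i₃, i₄⟩) n₁ n₂ i j e₁ e₂) h₀₁ h₁₀ hA₁ hD₀
    · exact ZMod.no_coupling_of_min ha hd he (by rwa [Finset.union_comm A₁]) hA' hD
        (fun a₀ i₁ a₁ i₂ d₀ i₃ d₁ i₄ n₁ n₂ i j e₁ e₂ => by
          have := hF a₁ i₂ a₀ i₁ d₁ d₀ (Or.inr ⟨i₄, i₃⟩) n₁.symm n₂.symm j i e₂ e₁; omega)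
        h₁₀ h₀₁ hA₀ hD₁
    · exact ZMod.no_coupling_of_min ha hd he
        (by rwa [Finset.union_comm A₁, Finset.union_comm D₁]) hA' hD'
        (fun a₀ i₁ a₁ i₂ d₀ i₃ d₁ i₄ n₁ n₂ i j e₁ e₂ => by
          have := hF a₁ i₂ a₀ i₁ d₁ d₀ (Or.inl ⟨i₄, i₃⟩) n₁.symm n₂.symm j i e₂ e₁; omega)
        h₁₁ h₀₀ hA₀ hD₀
  · -- exchange the two families, shifting `D₀`, `D₁` by `-1`
    have hinj : Function.Injective fun x : ZMod c => x - 1 := sub_left_injective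
    have hcard : ∀ D : Finset (ZMod c), (D.image fun x : ZMod c => x - 1).card = D.card :=
      fun D => Finset.card_image_of_injective _ hinj
    have hmem : ∀ (D : Finset (ZMod c)) (x : ZMod c), (x ∈ D.image fun x : ZMod c => x - 1) ↔ x + 1 ∈ D := by
      intro D x
      constructor
      · intro hx; obtain ⟨y, hy, rfl⟩ := Finset.mem_image.1 hx; simpa using hy
      · intro hx; exact Finset.mem_image.2 ⟨x + 1, hx, by ring⟩
    have hs : ∀ {D D' : Finset (ZMod c)},
        (∀ d₀ ∈ D, ∀ d₁ ∈ D', d₀ ≠ d₁ → ∀ k : ℤ, |k| ≤ s → d₁ ≠ d₀ + k) →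
        ∀ d₀ ∈ D.image (fun x : ZMod c => x - 1), ∀ d₁ ∈ D'.image (fun x : ZMod c => x - 1), d₀ ≠ d₁ →
          ∀ k : ℤ, |k| ≤ s → d₁ ≠ d₀ + k := by
      intro D D' H d₀ h₀ d₁ h₁ hne k hk e
      rw [hmem] at h₀ h₁
      exact H _ h₀ _ h₁ (fun e => hne (add_right_cancel e)) k hk (by rw [e]; ring)
    have hm : ∀ a ∈ D₀.image (fun x : ZMod c => x - 1) ∪ D₁.image (fun x : ZMod c => x - 1), ∀ d ∈ A₀ ∪ A₁,
        ∀ k : ℕ, k < f → a ≠ d + k ∧ d ≠ a + 1 + k := by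
      intro a ha d hd k hk
      rw [Finset.mem_union, hmem, hmem, ← Finset.mem_union] at ha
      have := hmin d hd (a + 1) ha k hk
      exact ⟨fun e => this.2 (by rw [e]; ring), fun e => this.1 e⟩
    have mem' : ∀ {D : Finset (ZMod c)}, d ∈ D → d - 1 ∈ D.image (fun x : ZMod c => x - 1) := fun h =>
      Finset.mem_image_of_mem _ h
    have he' : d - 1 = a + f := by rw [he]; ring
    rcases ha with ha | ha <;> rcases hd with hd | hd
    · exact ZMod.no_coupling_of_min (r := s) (s := r) (mem' hd) ha he' hm (hs hD) hA
        (fun a₀ i₁ a₁ i₂ d₀ i₃ d₁ i₄ n₁ n₂ i j e₁ e₂ => by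
          rw [hmem] at i₁ i₂
          have := hB d₀ i₃ d₁ i₄ (a₀ + 1) (a₁ + 1) (Or.inl ⟨i₁, i₂⟩) n₂
            (fun e => n₁ (add_right_cancel e)) i j (by rw [e₁]; ring) (by rw [e₂]; ring)
          omega) (by rw [hcard]; omega) (by rw [hcard]; omega) (by rw [hcard]; omega) hA₁
    · exact ZMod.no_coupling_of_min (r := s) (s := r) (mem' hd) ha he'
        (by rwa [Finset.union_comm (D₁.image _)]) (hs hD') hA
        (fun a₀ i₁ a₁ i₂ d₀ i₃ d₁ i₄ n₁ n₂ i j e₁ e₂ => by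
          rw [hmem] at i₁ i₂
          have := hB d₀ i₃ d₁ i₄ (a₀ + 1) (a₁ + 1) (Or.inr ⟨i₁, i₂⟩) n₂
            (fun e => n₁ (add_right_cancel e)) i j (by rw [e₁]; ring) (by rw [e₂]; ring)
          omega) (by rw [hcard]; omega) (by rw [hcard]; omega) (by rw [hcard]; omega) hA₁
    · exact ZMod.no_coupling_of_min (r := s) (s := r) (mem' hd) ha he'
        (by rwa [Finset.union_comm A₁]) (hs hD) hA'
        (fun a₀ i₁ a₁ i₂ d₀ i₃ d₁ i₄ n₁ n₂ i j e₁ e₂ => by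
          rw [hmem] at i₁ i₂
          have := hB d₁ i₄ d₀ i₃ (a₁ + 1) (a₀ + 1) (Or.inr ⟨i₂, i₁⟩) n₂.symm
            (fun e => n₁ (add_right_cancel e).symm) j i (by rw [e₂]; ring) (by rw [e₁]; ring)
          omega) (by rw [hcard]; omega) (by rw [hcard]; omega) (by rw [hcard]; omega) hA₀
    · exact ZMod.no_coupling_of_min (r := s) (s := r) (mem' hd) ha he'
        (by rwa [Finset.union_comm A₁, Finset.union_comm (D₁.image _)]) (hs hD') hA'
        (fun a₀ i₁ a₁ i₂ d₀ i₃ d₁ i₄ n₁ n₂ i j e₁ e₂ => by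
          rw [hmem] at i₁ i₂
          have := hB d₁ i₄ d₀ i₃ (a₁ + 1) (a₀ + 1) (Or.inl ⟨i₂, i₁⟩) n₂.symm
            (fun e => n₁ (add_right_cancel e).symm) j i (by rw [e₂]; ring) (by rw [e₁]; ring)
          omega) (by rw [hcard]; omega) (by rw [hcard]; omega) (by rw [hcard]; omega) hA₀

end ZModSets

/-- The residues `i` for which `u` is adjacent to `z (2 * i + ε)`. -/
def attach {V : Type*} (G : SimpleGraph V) (z : ℤ → V) (c : ℕ) [NeZero c] (ε : ℤ) (u : V) :
    Finset (ZMod c) :=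
  Finset.univ.filter fun i => G.Adj u (z (2 * (i.cast : ℤ) + ε))

/-- The number of neighbours of `u` among the values of `z`. -/
def cycleDegree {V : Type*} [Fintype V] (G : SimpleGraph V) (z : ℤ → V) (u : V) : ℕ :=
  (Finset.univ.filter fun v => G.Adj u v ∧ ∃ i, v = z i).card

/-- The parity of the positions on the cycle to which a vertex of the given colour can attach. -/
def colOffset (b : Bool) : ℤ := if b then 1 else 0

theorem cycleDegree_shift {V : Type*} [Fintype V] (G : SimpleGraph V) (z : ℤ → V) (u : V) :
    cycleDegree G (fun i => z (i + 1)) u = cycleDegree G z u := by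
  unfold cycleDegree
  congr 1
  ext v
  simp only [Finset.mem_filter, Finset.mem_univ, true_and, and_congr_right_iff]
  rintro -
  exact ⟨fun ⟨i, hi⟩ => ⟨i + 1, hi⟩, fun ⟨i, hi⟩ => ⟨i - 1, by rw [hi]; congr 1; ring⟩⟩

namespace CycleSetup
variable {V : Type*} {G : SimpleGraph V} {col : V → Bool} {c : ℕ} {z : ℤ → V}

theorem neZero (h : CycleSetup G col c z) : NeZero c := ⟨by have := h.two_le; omega⟩

theorem col_cycle (h : CycleSetup G col c z) (i : ℤ) : col (z i) = decide (i % 2 = 0) := by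
  rcases Int.even_or_odd' i with ⟨k, rfl | rfl⟩
  · simp [h.col_even]
  · simp [h.col_odd, Int.add_emod]

theorem mem_attach_iff (h : CycleSetup G col c z) [NeZero c] (ε k : ℤ) (u : V) :
    (k : ZMod c) ∈ attach G z c ε u ↔ G.Adj u (z (2 * k + ε)) := by
  have : z (2 * (((k : ZMod c).cast : ℤ)) + ε) = z (2 * k + ε) := by
    rw [h.inj]
    have h1 : (((k : ZMod c).cast : ℤ) : ZMod c) = (k : ZMod c) := ZMod.intCast_zmod_cast _
    rw [ZMod.intCast_eq_intCast_iff_dvd_sub] at h1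
    obtain ⟨m, hm⟩ := h1
    exact ⟨-m, by linear_combination (-2) * hm⟩
  simp [attach, this]

theorem adj_parity (h : CycleSetup G col c z) {u : V} {i : ℤ} (hu : G.Adj u (z i)) :
    ∃ k, i = 2 * k + colOffset (col u) := by
  have := h.bip _ _ hu
  rw [h.col_cycle] at this
  unfold colOffset
  by_cases hi : i % 2 = 0
  · exact ⟨i / 2, by cases hc : col u <;> simp_all; omega⟩
  · exact ⟨i / 2, by cases hc : col u <;> simp_all; omega⟩

variable [Fintype V]

theorem cycleDegree_eq (h : CycleSetup G col c z) [NeZero c] (u : V) :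
    cycleDegree G z u = (attach G z c (colOffset (col u)) u).card := by
  symm
  refine Finset.card_bij (fun i _ => z (2 * (i.cast : ℤ) + colOffset (col u))) ?_ ?_ ?_
  · intro i hi
    simp only [Finset.mem_filter, Finset.mem_univ, true_and]
    refine ⟨?_, _, rfl⟩
    rw [← h.mem_attach_iff, ZMod.intCast_zmod_cast]; exact hi
  · intro i _ j _ e
    rw [h.inj] at e
    rw [← ZMod.intCast_zmod_cast i, ← ZMod.intCast_zmod_cast j, ZMod.intCast_eq_intCast_iff_dvd_sub]
    obtain ⟨m, hm⟩ := e
    exact ⟨-m, by linarith⟩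
  · intro v hv
    simp only [Finset.mem_filter, Finset.mem_univ, true_and] at hv
    obtain ⟨hv, i, rfl⟩ := hv
    obtain ⟨k, rfl⟩ := h.adj_parity hv
    refine ⟨k, (h.mem_attach_iff _ _ _).2 hv, ?_⟩
    have h1 : (((k : ZMod c).cast : ℤ) : ZMod c) = (k : ZMod c) := ZMod.intCast_zmod_cast _
    rw [ZMod.intCast_eq_intCast_iff_dvd_sub] at h1
    obtain ⟨m, hm⟩ := h1
    rw [h.inj]
    exact ⟨-m, by linear_combination (-2) * hm⟩

theorem cycleDegree_pos (h : CycleSetup G col c z) {u : V} {i : ℤ} (hu : G.Adj u (z i)) :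
    1 ≤ cycleDegree G z u :=
  Finset.card_pos.2 ⟨z i, by simp only [Finset.mem_filter, Finset.mem_univ, true_and]; exact ⟨hu, i, rfl⟩⟩

theorem exists_adj_of_cycleDegree_pos (u : V) (hu : 1 ≤ cycleDegree G z u) :
    ∃ i, G.Adj u (z i) := by
  obtain ⟨v, hv⟩ := Finset.card_pos.1 hu
  simp only [Finset.mem_filter, Finset.mem_univ, true_and] at hv
  obtain ⟨hv, i, rfl⟩ := hv
  exact ⟨i, hv⟩

theorem exists_adj_ne {u w : V} (hu : 2 ≤ cycleDegree G z u) :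
    ∃ i, G.Adj u (z i) ∧ z i ≠ w := by
  obtain ⟨v, hv, hne⟩ := Finset.exists_mem_ne hu w
  simp only [Finset.mem_filter, Finset.mem_univ, true_and] at hv
  obtain ⟨hv, i, rfl⟩ := hv
  exact ⟨i, hv, hne⟩

theorem cycleDegree_le_one (h : CycleSetup G col c z) {u w : V}
    (hu : ∀ i, G.Adj u (z i) → z i = w) : cycleDegree G z u ≤ 1 := by
  by_contra hcon
  obtain ⟨i, h1, h2⟩ := exists_adj_ne (G := G) (z := z) (u := u) (w := w) (by omega)
  exact h2 (hu i h1)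

variable {W : Finset V} {a b u v : V} {l l' : List V}

/-- Ears of a longest cycle have fewer than `c` inner vertices. -/
theorem length_ear_lt (h : CycleSetup G col c z) (hW : ∀ w ∈ W, ∀ i, w ≠ z i)
    (hl : GPath G W a b l) {p q : ℤ} (ha : G.Adj a (z p)) (hb : G.Adj b (z q))
    (hpq : z p ≠ z q) : l.length + 1 ≤ c := by
  obtain ⟨k, hk, h1, h2⟩ := h.exists_shift hpq
  rw [← hk] at hb hpq
  have h3 := h.length_add_one_le_sub hW hl ha hb h1 h2
  have e : z (p + 2 * c) = z p := (h.inj _ _).2 ⟨1, by ring⟩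
  have h4 := h.length_add_one_le_sub hW hl.reverse hb (e ▸ ha) h2 (by omega)
  simp at h4
  omega

theorem attach_spread (h : CycleSetup G col c z) [NeZero c] (hW : ∀ w ∈ W, ∀ i, w ≠ z i)
    (hl : GPath G W u v l) {ε : ℤ} {r : ℕ} (hr : 2 * r ≤ l.length) :
    ∀ a₀ ∈ attach G z c ε u, ∀ a₁ ∈ attach G z c ε v, a₀ ≠ a₁ → ∀ k : ℤ, |k| ≤ r → a₁ ≠ a₀ + k := by
  intro a₀ h₀ a₁ h₁ hne k hk e
  rw [e, ← ZMod.intCast_zmod_cast a₀, ← Int.cast_add, h.mem_attach_iff] at h₁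
  rw [← ZMod.intCast_zmod_cast a₀, h.mem_attach_iff] at h₀
  have := h.length_add_one_le_abs hW hl h₀ h₁ (by
    intro e2
    rw [h.inj] at e2
    obtain ⟨m, hm⟩ := e2
    apply hne
    rw [e, left_eq_add]
    have : k = c * (-m) := by linarith
    rw [this]; simp)
  have e3 : 2 * (a₀.cast + k) + ε - (2 * a₀.cast + ε) = 2 * k := by ring
  rw [e3, abs_mul] at this
  rw [abs_two] at this
  omega

theorem cycleDegree_add_cycleDegree_add_length_le (h : CycleSetup G col c z)
    (hW : ∀ w ∈ W, ∀ i, w ≠ z i) (hl : GPath G W u v l) (huv : col u ≠ col v)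
    (hu : 1 ≤ cycleDegree G z u) (hv : 1 ≤ cycleDegree G z v) :
    cycleDegree G z u + cycleDegree G z v + l.length ≤ c + 1 := by
  wlog hc : col u = true generalizing u v l
  · have := this hl.reverse huv.symm hv hu (by cases h1 : col u <;> cases h2 : col v <;> simp_all)
    rw [List.length_reverse] at this; omega
  have := h.neZero
  have hc' : col v = false := by cases h2 : col v <;> simp_all
  rw [h.cycleDegree_eq] at hu hv ⊢
  rw [h.cycleDegree_eq] at ⊢
  have := hl.two_mul_countP h.bip true
  simp only [hc, hc', colOffset, if_true] at hu hv ⊢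
  simp only [hc, hc', Bool.false_eq_true, if_true, if_false] at this
  have h0 := hl.length_pos
  have key := ZMod.card_add_card_add_le (S := attach G z c 0 v) (T := attach G z c 1 u)
    (Finset.card_pos.1 (by simpa using hv)) (Finset.card_pos.1 hu) (n := l.length) (by omega)
    (lo := -(l.length / 2 : ℕ)) (by
      intro d hd a ha k h1 h2 e
      rw [e, ← ZMod.intCast_zmod_cast d, ← Int.cast_add, h.mem_attach_iff] at ha
      rw [← ZMod.intCast_zmod_cast d, h.mem_attach_iff] at hd
      have h3 := h.length_add_one_le_abs hW hl.reverse hd ha (by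
        intro e2
        have e3 := congrArg col e2
        simp [h.col_odd, h.col_even] at e3)
      have e3 : 2 * (d.cast + k) + 1 - (2 * d.cast + 0) = 2 * k + 1 := by ring
      rw [e3, List.length_reverse] at h3
      rcases abs_cases (2 * k + 1) with h4 | h4 <;> omega)
  simp only [Bool.false_eq_true, if_false]
  omega

theorem cycleDegree_add_length_le (h : CycleSetup G col c z)
    (hW : ∀ w ∈ W, ∀ i, w ≠ z i) (hl : GPath G W u b l) {p : ℤ} (hb : G.Adj b (z p))
    (hu : 2 ≤ cycleDegree G z u) : cycleDegree G z u + l.length ≤ c + 1 := by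
  by_cases hc : col u = col b
  swap
  · have := h.cycleDegree_add_cycleDegree_add_length_le hW hl hc (by omega) (h.cycleDegree_pos hb)
    have := h.cycleDegree_pos hb
    omega
  have := h.neZero
  obtain ⟨w, rfl⟩ := h.adj_parity hb
  rw [← hc] at hb
  rw [h.cycleDegree_eq] at *
  set ε := colOffset (col u)
  have := hl.two_mul_countP h.bip (col u)
  simp only [hc, if_true] at this
  have hb' := (h.mem_attach_iff ε w b).2 hb
  have h1 := Finset.pred_card_le_card_erase (s := attach G z c ε u) (a := (w : ZMod c))
  have hsp := h.attach_spread hW hl (ε := ε) (r := l.length / 2) (by omega)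
  have key := ZMod.card_add_card_add_le (S := (attach G z c ε u).erase w) (T := {(w : ZMod c)})
    (Finset.card_pos.1 (by omega)) ⟨w, by simp⟩ (n := l.length) (by omega)
    (lo := -(l.length / 2 : ℕ)) (by
      intro d hd a ha k h1 h2 e
      rw [Finset.mem_singleton] at ha
      rw [Finset.mem_erase] at hd
      subst ha
      exact hsp d hd.2 _ hb' hd.1 k (by rw [abs_le]; omega) e)
  rw [Finset.card_singleton] at key
  omega

theorem cycleDegree_ends_le (h : CycleSetup G col c z)
    (hW : ∀ w ∈ W, ∀ i, w ≠ z i) (hl : GPath G W u v l) (hc : col u = col v) (h2 : 2 ≤ l.length)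
    (hu : 2 ≤ cycleDegree G z u) (hv : 2 ≤ cycleDegree G z v) :
    cycleDegree G z u + cycleDegree G z v + l.length ≤ c + 3 := by
  have := h.neZero
  have hlt : l.length + 1 ≤ c := by
    obtain ⟨i, hi⟩ := exists_adj_of_cycleDegree_pos (G := G) (z := z) u (by omega)
    obtain ⟨j, hj, hne⟩ := exists_adj_ne (w := z i) hv
    exact h.length_ear_lt hW hl hi hj hne.symm
  have := hl.two_mul_countP h.bip (col u)
  simp only [hc, if_true] at this
  rw [h.cycleDegree_eq] at hu hv ⊢
  rw [h.cycleDegree_eq] at ⊢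
  rw [← hc] at *
  have key := ZMod.card_add_card_add_two_mul_le (r := l.length / 2) (by omega) hu hv (by omega)
    (h.attach_spread hW hl (by omega))
  omega

/-- An isolated attached vertex and an ear disjoint from it. -/
theorem cycleDegree_add_half_length_le (h : CycleSetup G col c z)
    (hW : ∀ w ∈ W, ∀ i, w ≠ z i) (hl : GPath G W a b l) (hu : u ∈ W) (hul : u ∉ l)
    {p q : ℤ} (ha : G.Adj a (z p)) (hb : G.Adj b (z q)) (hpq : z p ≠ z q) :
    cycleDegree G z u + l.length / 2 ≤ c := by
  have := h.neZero
  obtain ⟨k, hk, hpq1, hpq2⟩ := h.exists_shift hpq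
  rw [← hk] at hb hpq
  set q := q + 2 * c * k
  have e : z (p + 2 * c) = z p := (h.inj _ _).2 ⟨1, by ring⟩
  have h3 := h.length_add_one_le_sub hW hl ha hb hpq1 hpq2
  have h4 := h.length_add_one_le_sub hW hl.reverse hb (e ▸ ha) hpq2 (by omega)
  rw [List.length_reverse] at h4
  rw [h.cycleDegree_eq]
  set ε := colOffset (col u) with hε
  have gap : ∀ lo : ℤ, (∀ x, lo < x → x ≤ lo + l.length → ¬ G.Adj u (z x)) →
      (attach G z c ε u).card + l.length / 2 ≤ c := by
    intro lo hlo
    have := ZMod.card_add_card_le_of_window (c := c) (A := attach G z c ε u)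
      (J := Finset.Ico ((lo + 2 - ε) / 2) ((lo + 2 - ε) / 2 + (l.length / 2 : ℕ)))
      (lo := (lo + 2 - ε) / 2) (by intro k hk; rw [Finset.mem_Ico] at hk; omega) (by
        intro k hk
        rw [Finset.mem_Ico] at hk
        rw [h.mem_attach_iff]
        exact hlo _ (by omega) (by omega))
    rw [Int.card_Ico] at this
    omega
  by_cases hx : ∃ x, (p < x ∧ x < q) ∧ G.Adj u (z x)
  swap
  · push Not at hx
    exact gap p fun x h1 h2 => hx x ⟨h1, by omega⟩
  by_cases hx' : ∃ x, (q < x ∧ x < p + 2 * c) ∧ G.Adj u (z x)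
  swap
  · push Not at hx'
    exact gap q fun x h1 h2 => hx' x ⟨h1, by omega⟩
  obtain ⟨x, ⟨⟨hx1, hx2⟩, hx3⟩, hxmin⟩ := Int.exists_least_of_bdd ⟨p, fun y hy => hy.1.1.le⟩ hx
  obtain ⟨y, ⟨⟨hy1, hy2⟩, hy3⟩, hymin⟩ := Int.exists_least_of_bdd ⟨q, fun y hy => hy.1.1.le⟩ hx'
  have hcr := h.crossing hW (GPath.single hu) hl (by simpa using hul) hx3 hy3 ha hb hx1 hx2 hy1 hy2
  obtain ⟨X, hX⟩ := h.adj_parity hx3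
  obtain ⟨Y, hY⟩ := h.adj_parity hy3
  obtain ⟨P, hP⟩ := h.adj_parity ha
  obtain ⟨Q, hQ⟩ := h.adj_parity hb
  have hpar := hl.two_mul_countP h.bip (col u)
  have := ZMod.card_add_card_le_of_window (c := c) (A := attach G z c ε u)
    (J := Finset.Ico ((p + 2 - ε) / 2) X ∪ Finset.Ico ((q + 2 - ε) / 2) Y)
    (lo := (p + 2 - ε) / 2) (by
      intro k hk
      rw [Finset.mem_union, Finset.mem_Ico, Finset.mem_Ico] at hk
      omega) (by
      intro k hk
      rw [Finset.mem_union, Finset.mem_Ico, Finset.mem_Ico] at hk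
      rw [h.mem_attach_iff]
      intro hadj
      rcases hk with hk | hk
      · have := hxmin _ ⟨⟨by omega, by omega⟩, hadj⟩; omega
      · have := hymin _ ⟨⟨by omega, by omega⟩, hadj⟩; omega)
  rw [Finset.card_union_of_disjoint, Int.card_Ico, Int.card_Ico] at this
  · rw [List.length_singleton] at hcr
    have hpar' : (colOffset (col a) = colOffset (col b) → l.length % 2 = 1) ∧
        (colOffset (col a) ≠ colOffset (col b) → l.length % 2 = 0) := by
      revert hpar
      unfold colOffset
      cases col a <;> cases col b <;> cases col u <;> simp <;> omega
    have ea : colOffset (col a) = 0 ∨ colOffset (col a) = 1 := by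
      unfold colOffset; cases col a <;> simp
    have eb : colOffset (col b) = 0 ∨ colOffset (col b) = 1 := by
      unfold colOffset; cases col b <;> simp
    have eu : ε = 0 ∨ ε = 1 := by
      rw [hε]; unfold colOffset; cases col u <;> simp
    omega
  · rw [Finset.disjoint_left]
    intro k hk hk'
    rw [Finset.mem_Ico] at hk hk'
    omega

theorem add_le_offset_add_offset (h : CycleSetup G col c z) (hW : ∀ w ∈ W, ∀ i, w ≠ z i)
    {u₀ u₁ v₀ v₁ : V} (hl : GPath G W u₀ u₁ l) (hl' : GPath G W v₀ v₁ l')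
    (hd : ∀ x ∈ l, x ∉ l') {r s : ℕ} (hr : l.length = 2 * r + 1) (hs : l'.length = 2 * s + 1)
    {ε D t : ℤ} {i j : ℕ} (ht₀ : 0 < t) (ht : t < c) (hv₀ : G.Adj v₀ (z (2 * D + ε)))
    (hv₁ : G.Adj v₁ (z (2 * (D + t) + ε))) (hu₀ : G.Adj u₀ (z (2 * (D + i) + ε + 1)))
    (hu₁ : G.Adj u₁ (z (2 * (D + t + j) + ε + 1)))
    (hne : z (2 * (D + i) + ε + 1) ≠ z (2 * (D + t + j) + ε + 1)) : r + s + 1 ≤ i + j := by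
  have e : ∀ x, z (x + 2 * c) = z x := fun x => (h.inj _ _).2 ⟨1, by ring⟩
  have hne' : z (2 * D + ε) ≠ z (2 * (D + t) + ε) := by
    intro e
    rw [h.inj] at e
    have h1 := Int.le_of_dvd (by omega) ((dvd_neg.2 e))
    omega
  have L1 := h.length_add_one_le_abs hW hl hu₀ hu₁ hne
  have L2 := h.length_add_one_le_abs hW hl' hv₀ hv₁ hne'
  have L3 := h.length_add_one_le_abs hW hl (q := 2 * (D + t + j) + ε + 1)
    (p := 2 * (D + i) + ε + 1 + 2 * c) (by rwa [e]) hu₁ (by rwa [e])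
  have L4 := h.length_add_one_le_abs hW hl' (p := 2 * D + ε + 2 * c) (by rwa [e]) hv₁ (by rwa [e])
  by_cases h1 : t ≤ i
  · rcases abs_cases (2 * (D + t + j) + ε + 1 - (2 * (D + i) + ε + 1)) with h4 | h4 <;>
    rcases abs_cases (2 * (D + t) + ε - (2 * D + ε)) with h5 | h5 <;> omega
  by_cases h2 : c ≤ t + j
  · rcases abs_cases (2 * (D + t + j) + ε + 1 - (2 * (D + i) + ε + 1 + 2 * c)) with h4 | h4 <;>
    rcases abs_cases (2 * (D + t) + ε - (2 * D + ε + 2 * c)) with h5 | h5 <;> omega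
  have := h.crossing hW hl hl' hd hu₀ hu₁ hv₀ hv₁ (by omega) (by omega) (by omega) (by omega)
  omega

theorem exists_offset [NeZero c] {d₀ d₁ : ZMod c} (hne : d₀ ≠ d₁) :
    ∃ t : ℤ, 0 < t ∧ t < c ∧ d₁ = ((d₀.cast + t : ℤ) : ZMod c) := by
  refine ⟨(d₁ - d₀).val, ?_, ?_, ?_⟩
  · have : (d₁ - d₀).val ≠ 0 := by
      rw [Ne, ZMod.val_eq_zero, sub_eq_zero]; exact hne.symm
    omega
  · exact_mod_cast ZMod.val_lt _
  · push_cast; simp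

theorem no_coupling (h : CycleSetup G col c z) (hW : ∀ w ∈ W, ∀ i, w ≠ z i)
    {u₀ u₁ v₀ v₁ : V} (hl : GPath G W u₀ u₁ l) (hl' : GPath G W v₀ v₁ l')
    (hd : ∀ x ∈ l, x ∉ l') {r s : ℕ} (hr : l.length = 2 * r + 1) (hs : l'.length = 2 * s + 1)
    (hu : col u₀ = true) (hv : col v₀ = false)
    (h₀₀ : c + 2 ≤ cycleDegree G z u₀ + cycleDegree G z v₀ + r + s)
    (h₀₁ : c + 2 ≤ cycleDegree G z u₀ + cycleDegree G z v₁ + r + s)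
    (h₁₀ : c + 2 ≤ cycleDegree G z u₁ + cycleDegree G z v₀ + r + s)
    (h₁₁ : c + 2 ≤ cycleDegree G z u₁ + cycleDegree G z v₁ + r + s)
    (hu₀ : 2 ≤ cycleDegree G z u₀) (hu₁ : 2 ≤ cycleDegree G z u₁)
    (hv₀ : 2 ≤ cycleDegree G z v₀) (hv₁ : 2 ≤ cycleDegree G z v₁) : False := by
  have := h.neZero
  have hu' : col u₁ = true := by
    have := hl.two_mul_countP h.bip true
    by_contra hcon
    simp [hu, hcon] at this
    omega
  have hv' : col v₁ = false := by
    have := hl'.two_mul_countP h.bip false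
    by_contra hcon
    simp [hv, hcon] at this
    omega
  simp only [h.cycleDegree_eq, hu, hu', hv, hv', colOffset, if_true] at *
  simp only [Bool.false_eq_true, if_false] at *
  have memE : ∀ {ε : ℤ} {d : ZMod c} {x : V} (k : ℤ), d ∈ attach G z c ε x → d = (k : ZMod c) →
      G.Adj x (z (2 * k + ε)) := by
    intro ε d x k hd e
    rwa [e, h.mem_attach_iff] at hd
  have zne : ∀ {ε : ℤ} {d d' : ZMod c} (k k' : ℤ), d ≠ d' → d = (k : ZMod c) →
      d' = (k' : ZMod c) → z (2 * k + ε) ≠ z (2 * k' + ε) := by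
    intro ε d d' k k' hne e e' hz
    apply hne
    rw [h.inj] at hz
    rw [e, e', ZMod.intCast_eq_intCast_iff_dvd_sub]
    obtain ⟨m, hm⟩ := hz
    exact ⟨-m, by linarith⟩
  have fwd : ∀ {x₀ x₁ y₀ y₁ : V} {L L' : List V} {r s : ℕ}, GPath G W x₀ x₁ L →
      GPath G W y₀ y₁ L' → (∀ x ∈ L, x ∉ L') → L.length = 2 * r + 1 → L'.length = 2 * s + 1 →
      ∀ {ε ε' : ℤ}, (∃ m, ε' = ε + 1 + 2 * m) →
      ∀ a₀ ∈ attach G z c ε' x₀, ∀ a₁ ∈ attach G z c ε' x₁, ∀ d₀ ∈ attach G z c ε y₀,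
      ∀ d₁ ∈ attach G z c ε y₁, a₀ ≠ a₁ → d₀ ≠ d₁ → ∀ i j : ℕ,
      a₀ = d₀ + i + (((ε + 1 - ε') / 2 : ℤ) : ZMod c) →
      a₁ = d₁ + j + (((ε + 1 - ε') / 2 : ℤ) : ZMod c) → r + s + 1 ≤ i + j := by
    rintro x₀ x₁ y₀ y₁ L L' r s hL hL' hd hr hs ε ε' ⟨m, hm⟩ a₀ ha₀ a₁ ha₁ d₀ hd₀ d₁ hd₁ hna hnd i
      j e₀ e₁
    obtain ⟨t, ht0, htc, ht⟩ := exists_offset hnd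
    have hm' : (ε + 1 - ε') / 2 = -m := by omega
    rw [hm'] at e₀ e₁
    have E₀ : a₀ = ((d₀.cast + i - m : ℤ) : ZMod c) := by
      rw [e₀]; push_cast; ring
    have E₁ : a₁ = ((d₀.cast + t + j - m : ℤ) : ZMod c) := by
      rw [e₁, ht]; push_cast; ring
    have eq₀ : 2 * (d₀.cast + i - m) + ε' = 2 * (d₀.cast + i) + ε + 1 := by rw [hm]; ring
    have eq₁ : 2 * (d₀.cast + t + j - m) + ε' = 2 * (d₀.cast + t + j) + ε + 1 := by rw [hm]; ring
    refine h.add_le_offset_add_offset hW hL hL' hd hr hs ht0 htc (ε := ε) (D := d₀.cast)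
      (memE _ hd₀ (by simp)) (memE _ hd₁ ht) ?_ ?_ ?_
    · rw [← eq₀]; exact memE _ ha₀ E₀
    · rw [← eq₁]; exact memE _ ha₁ E₁
    · rw [← eq₀, ← eq₁]; exact zne _ _ hna E₀ E₁
  refine ZMod.no_coupling (r := r) (s := s) (h.attach_spread hW hl (by omega))
    (h.attach_spread hW hl' (by omega)) ?_ ?_ h₀₀ h₀₁ h₁₀ h₁₁ hu₀ hu₁ hv₀ hv₁
  · rintro a₀ ha₀ a₁ ha₁ d₀ d₁ (⟨hd₀, hd₁⟩ | ⟨hd₀, hd₁⟩) hna hnd i j e₀ e₁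
    · exact fwd hl hl' hd hr hs ⟨0, by simp⟩ a₀ ha₀ a₁ ha₁ d₀ hd₀ d₁ hd₁ hna hnd i j
        (by simpa using e₀) (by simpa using e₁)
    · exact fwd hl hl'.reverse (by simpa using hd) hr (by simpa using hs) ⟨0, by simp⟩
        a₀ ha₀ a₁ ha₁ d₀ hd₀ d₁ hd₁ hna hnd i j (by simpa using e₀) (by simpa using e₁)
  · have hd' : ∀ x ∈ l', x ∉ l := fun x hx hx' => hd x hx' hx
    rintro a₀ ha₀ a₁ ha₁ d₀ d₁ (⟨hd₀, hd₁⟩ | ⟨hd₀, hd₁⟩) hna hnd i j e₀ e₁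
    · have := fwd hl' hl hd' hs hr (ε := 1) (ε' := 0) ⟨-1, by simp⟩ d₀ hd₀ d₁ hd₁ a₀ ha₀ a₁ ha₁
        hnd hna i j (by rw [e₀]; norm_num; ring) (by rw [e₁]; norm_num; ring)
      omega
    · have := fwd hl'.reverse hl (by simpa using hd') (by simpa using hs) hr (ε := 1) (ε' := 0)
        ⟨-1, by simp⟩ d₀ hd₀ d₁ hd₁ a₀ ha₀ a₁ ha₁
        hnd hna i j (by rw [e₀]; norm_num; ring) (by rw [e₁]; norm_num; ring)
      omega

end CycleSetup

namespace GPath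
variable {V : Type*} {G : SimpleGraph V} {S T : Finset V} {a b d x y : V} {l l' : List V}

/-- Split a path at its first vertex with property `P`. -/
theorem exists_first (h : GPath G S a b l) {P : V → Prop} (ha : ¬ P a) (hb : P b) :
    ∃ l₁ x y l₂, l = l₁ ++ y :: l₂ ∧ GPath G S a x l₁ ∧ (∀ v ∈ l₁, ¬ P v) ∧ P y ∧ G.Adj x y := by
  induction l generalizing a with
  | nil => have := h.head; simp at this
  | cons v l ih =>
    have hv : v = a := by simpa using h.head
    subst hv
    cases l with
    | nil =>
      have hb' : v = b := by simpa using h.last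
      exact absurd (hb' ▸ hb) ha
    | cons w l =>
      have h' : GPath G S w b (w :: l) := h.right_of_eq (l₁ := [v]) rfl rfl
      have hadj : G.Adj v w := by
        have := h.chain; rw [List.isChain_cons_cons] at this; exact this.1
      have hvS := h.sub v (by simp)
      by_cases hw : P w
      · exact ⟨[v], v, w, l, rfl, single hvS, by simpa using ha, hw, hadj⟩
      · obtain ⟨l₁, x, y, l₂, e, h1, h2, h3, h4⟩ := ih h' hw
        refine ⟨v :: l₁, x, y, l₂, by rw [e]; rfl, h1.cons hadj hvS ?_, ?_, h3, h4⟩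
        · intro hmem
          have := h.nodup
          rw [e, List.nodup_cons] at this
          exact this.1 (by simp [hmem])
        · intro u hu
          rcases List.mem_cons.1 hu with rfl | hu
          exacts [ha, h2 u hu]

theorem exists_exit (h : GPath G S a b l) {P : V → Prop} (ha : P a) (hb : ¬ P b) :
    ∃ x ∈ l, ∃ y ∈ l, P x ∧ ¬ P y ∧ G.Adj x y := by
  obtain ⟨l₁, x, y, l₂, e, h1, h2, h3, h4⟩ := h.exists_first (P := fun v => ¬ P v) (by simpa) hb
  exact ⟨x, by simp [e, h1.last_mem], y, by simp [e], not_not.1 (h2 x h1.last_mem), h3, h4⟩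

theorem exists_step (h : GPath G S a b l) (hy : y ∈ S) (hadj : G.Adj b y) :
    ∃ l', GPath G S a y l' := by
  by_cases hyl : y ∈ l
  · obtain ⟨i, hi, rfl⟩ := h.exists_getElem hyl
    exact ⟨_, h.take_getElem hi⟩
  · exact ⟨_, h.concat hadj hy hyl⟩

theorem exists_trans (h : GPath G S a b l) (h' : GPath G S b d l') :
    ∃ l'', GPath G S a d l'' := by
  by_contra hcon
  obtain ⟨x, hx, y, hy, h1, h2, h3⟩ := h'.exists_exit (P := fun v => ∃ l'', GPath G S a v l'')
    ⟨l, h⟩ hcon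
  obtain ⟨l₁, h1⟩ := h1
  exact h2 (h1.exists_step (h'.sub y hy) h3)

theorem exists_of_mem (h : GPath G S a b l) (hx : x ∈ l) :
    ∃ l₁, GPath G S a x l₁ ∧ ∀ v ∈ l₁, v ∈ l := by
  obtain ⟨i, hi, rfl⟩ := h.exists_getElem hx
  exact ⟨_, h.take_getElem hi, fun v hv => List.mem_of_mem_take hv⟩

end GPath

section Components
variable {V : Type*} (G : SimpleGraph V)

/-- Any two vertices of `K` are joined by a path of `G` inside `K`. -/
def ConnOn (K : Finset V) : Prop := ∀ a ∈ K, ∀ b ∈ K, ∃ l, GPath G K a b l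

/-- `K` is a connected component of the subgraph of `G` induced on `S`. -/
structure IsComp (S K : Finset V) : Prop where
  nonempty : K.Nonempty
  sub : K ⊆ S
  conn : ConnOn G K
  closed : ∀ v ∈ K, ∀ w ∈ S, G.Adj v w → w ∈ K

/-- The component of `u` in the subgraph of `G` induced on `S`. -/
def compOf (S : Finset V) (u : V) : Finset V := S.filter fun v => ∃ l, GPath G S u v l

variable {G} {S T K K' : Finset V} {u v w : V}

theorem gpath_compOf {l : List V} (h : GPath G S u v l) : GPath G (compOf G S u) u v l :=
  h.mono fun x hx => Finset.mem_filter.2 ⟨h.sub x hx, by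
    obtain ⟨l₁, h1, -⟩ := h.exists_of_mem hx; exact ⟨l₁, h1⟩⟩

theorem mem_compOf_self (hu : u ∈ S) : u ∈ compOf G S u :=
  Finset.mem_filter.2 ⟨hu, _, GPath.single hu⟩

theorem isComp_compOf (hu : u ∈ S) : IsComp G S (compOf G S u) where
  nonempty := ⟨u, mem_compOf_self hu⟩
  sub := Finset.filter_subset _ _
  conn a ha b hb := by
    obtain ⟨l, hl⟩ := (Finset.mem_filter.1 ha).2
    obtain ⟨l', hl'⟩ := (Finset.mem_filter.1 hb).2
    exact (gpath_compOf hl).reverse.exists_trans (gpath_compOf hl')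
  closed v hv w hw hadj := by
    obtain ⟨l, hl⟩ := (Finset.mem_filter.1 hv).2
    exact Finset.mem_filter.2 ⟨hw, hl.exists_step hw hadj⟩

theorem compOf_mono (h : S ⊆ T) : compOf G S u ⊆ compOf G T u := by
  intro v hv
  obtain ⟨h1, l, hl⟩ := Finset.mem_filter.1 hv
  exact Finset.mem_filter.2 ⟨h h1, l, hl.mono fun x hx => h (hl.sub x hx)⟩

theorem IsComp.gpath_sub (hK : IsComp G S K) {l : List V} (h : GPath G S u v l) {x : V}
    (hx : x ∈ l) (hxK : x ∈ K) : GPath G K u v l := by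
  have key : ∀ {a b : V} {l : List V}, GPath G S a b l → a ∈ K → ∀ y ∈ l, y ∈ K := by
    intro a b l h ha y hy
    by_contra hyK
    obtain ⟨l₁, h1, -⟩ := h.exists_of_mem hy
    obtain ⟨p, hp, q, hq, h2, h3, h4⟩ := h1.exists_exit (P := fun v => v ∈ K) ha hyK
    exact h3 (hK.closed p h2 q (h1.sub q hq) h4)
  have hu : u ∈ K := by
    obtain ⟨l₁, h1, -⟩ := h.exists_of_mem hx
    have := key h1.reverse hxK u (by simpa using h1.head_mem)
    exact this
  exact h.mono (key h hu)

/-- Number of vertices of colour `true` minus the number of vertices of colour `false`. -/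
def balance (col : V → Bool) (S : Finset V) : ℤ :=
  ((S.filter fun v => col v = true).card : ℤ) - (S.filter fun v => col v = false).card

variable (col : V → Bool)

theorem balance_swap : balance (fun v => !col v) S = - balance col S := by
  simp [balance]

theorem balance_union (h : Disjoint S T) : balance col (S ∪ T) = balance col S + balance col T := by
  unfold balance
  rw [Finset.filter_union, Finset.filter_union,
    Finset.card_union_of_disjoint (Finset.disjoint_filter_filter h),
    Finset.card_union_of_disjoint (Finset.disjoint_filter_filter h)]
  push_cast; ring

theorem balance_sdiff (h : T ⊆ S) : balance col (S \ T) = balance col S - balance col T := by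
  have := balance_union col (Finset.sdiff_disjoint (s := T) (t := S)).symm
  rw [Finset.union_sdiff_of_subset h] at this
  linarith

theorem balance_singleton (v : V) : balance col {v} = if col v = true then 1 else -1 := by
  cases h : col v <;> simp [balance, h, Finset.filter_singleton]

theorem balance_erase (h : v ∈ S) :
    balance col (S.erase v) = balance col S - if col v = true then 1 else -1 := by
  rw [← Finset.sdiff_singleton_eq_erase, balance_sdiff col (by simpa using h), balance_singleton]

theorem balance_toFinset {col : V → Bool} (bip : ∀ u v, G.Adj u v → col u ≠ col v) {l : List V}
    (h : GPath G S u v l) : 2 * balance col l.toFinset =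
      (if col u = true then 1 else -1) + (if col v = true then 1 else -1) := by
  have h1 := h.two_mul_countP bip true
  have h2 := h.two_mul_countP bip false
  have key : ∀ κ, (l.toFinset.filter fun v => col v = κ).card = l.countP fun v => col v == κ := by
    intro κ
    rw [List.countP_eq_length_filter, ← List.toFinset_card_of_nodup (h.nodup.filter _),
      List.toFinset_filter]
    congr 1
    ext; simp
  unfold balance
  rw [key, key]
  cases h3 : col u <;> cases h4 : col v <;> simp only [h3, h4, reduceCtorEq, if_true, if_false] at * <;>
    omega

theorem balance_le_of_comp (hS : ∀ K, IsComp G S K → balance col K ≤ 0) :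
    balance col S ≤ 0 ∧ ∀ K, IsComp G S K → balance col S ≤ balance col K := by
  induction' hn : S.card using Nat.strong_induction_on with n ih generalizing S
  have key : ∀ K, IsComp G S K → balance col S ≤ balance col K := by
    intro K hK
    have hlt : (S \ K).card < n := by
      rw [← hn]
      exact Finset.card_lt_card (Finset.sdiff_ssubset hK.sub hK.nonempty)
    have := (ih _ hlt (S := S \ K) (fun K' hK' => hS K' ⟨hK'.nonempty,
      hK'.sub.trans Finset.sdiff_subset, hK'.conn, fun v hv w hw hadj =>
        hK'.closed v hv w (Finset.mem_sdiff.2 ⟨hw, fun hwK => ?_⟩) hadj⟩) rfl).1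
    · rw [balance_sdiff col hK.sub] at this; omega
    · have h1 := Finset.mem_sdiff.1 (hK'.sub hv)
      exact h1.2 (hK.closed w hwK v h1.1 hadj.symm)
  refine ⟨?_, key⟩
  rcases S.eq_empty_or_nonempty with rfl | ⟨u, hu⟩
  · simp [balance]
  · exact (key _ (isComp_compOf hu)).trans (hS _ (isComp_compOf hu))

theorem exists_comp_balance_pos (hS : 1 ≤ balance col S) :
    ∃ K, IsComp G S K ∧ 1 ≤ balance col K := by
  by_contra! hcon
  have := (balance_le_of_comp (G := G) (S := S) col fun K hK => by
    have := hcon K hK; omega).1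
  omega

theorem exists_comp_balance_nonneg (hS : 0 ≤ balance col S) (hne : S.Nonempty) :
    ∃ K, IsComp G S K ∧ 0 ≤ balance col K := by
  by_contra! hcon
  obtain ⟨u, hu⟩ := hne
  have h1 := (balance_le_of_comp (G := G) (S := S) col fun K hK => by
    have := hcon K hK; omega).2 _ (isComp_compOf hu)
  have := hcon _ (isComp_compOf hu)
  omega

theorem IsComp.exists_adj {o : V} (hK : ConnOn G K) (ho : o ∈ K) (hK' : IsComp G (K.erase o) K') :
    ∃ y ∈ K', G.Adj o y := by
  obtain ⟨x, hx⟩ := hK'.nonempty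
  have hxK := Finset.mem_erase.1 (hK'.sub hx)
  obtain ⟨l, hl⟩ := hK x hxK.2 o ho
  obtain ⟨p, hp, q, hq, h1, h2, h3⟩ := hl.exists_exit (P := fun v => v ∈ K') hx
    (fun h => (Finset.mem_erase.1 (hK'.sub h)).1 rfl)
  refine ⟨p, h1, ?_⟩
  by_cases hqo : q = o
  · exact hqo ▸ h3.symm
  · exact absurd (hK'.closed p h1 q (Finset.mem_erase.2 ⟨hqo, hl.sub q hq⟩) h3) h2

/-- In a connected bipartite graph with a favourable balance, some path from a given root ends at
a vertex of colour `true` all of whose neighbours are on the path. -/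
theorem exists_path_containing_neighbors {col : V → Bool}
    (bip : ∀ u v, G.Adj u v → col u ≠ col v) (hK : ConnOn G K) {o : V} (ho : o ∈ K)
    (hb : col o = false ∧ 0 ≤ balance col K ∨ col o = true ∧ 1 ≤ balance col K) :
    ∃ u Q, col u = true ∧ GPath G K o u Q ∧ ∀ w ∈ K, G.Adj u w → w ∈ Q := by
  induction' hn : K.card using Nat.strong_induction_on with n ih generalizing K o
  have step : ∀ K', IsComp G (K.erase o) K' → (∀ o', G.Adj o o' →
      col o' = false ∧ 0 ≤ balance col K' ∨ col o' = true ∧ 1 ≤ balance col K') →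
      ∃ u Q, col u = true ∧ GPath G K o u Q ∧ ∀ w ∈ K, G.Adj u w → w ∈ Q := by
    intro K' hK' hb'
    obtain ⟨o', ho', hadj⟩ := hK'.exists_adj hK ho
    have hlt : K'.card < n := by
      rw [← hn]
      exact Finset.card_lt_card ⟨hK'.sub.trans (Finset.erase_subset _ _), fun h =>
        (Finset.mem_erase.1 (hK'.sub (h ho))).1 rfl⟩
    obtain ⟨u, Q, hu, hQ, hN⟩ := ih _ hlt hK'.conn ho' (hb' o' hadj) rfl
    refine ⟨u, o :: Q, hu, (hQ.mono (T := K) fun x hx =>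
      (Finset.mem_erase.1 (hK'.sub (hQ.sub x hx))).2).cons hadj ho fun h =>
        (Finset.mem_erase.1 (hK'.sub (hQ.sub o h))).1 rfl, fun w hw hadj => ?_⟩
    by_cases hwo : w = o
    · simp [hwo]
    · exact List.mem_cons_of_mem _ (hN w (hK'.closed u (hQ.sub u hQ.last_mem) w
        (Finset.mem_erase.2 ⟨hwo, hw⟩) hadj) hadj)
  have he := balance_erase col ho
  rcases hb with ⟨hc, hb⟩ | ⟨hc, hb⟩
  · simp only [hc, Bool.false_eq_true, if_false] at he
    obtain ⟨K', hK', hb'⟩ := exists_comp_balance_pos (G := G) col (S := K.erase o) (by omega)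
    refine step K' hK' fun o' hadj => Or.inr ⟨?_, hb'⟩
    have := bip _ _ hadj
    cases h : col o' <;> simp_all
  · simp only [hc, if_true] at he
    rcases (K.erase o).eq_empty_or_nonempty with hemp | hne
    · refine ⟨o, [o], hc, GPath.single ho, fun w hw hadj => ?_⟩
      by_contra hwo
      have : w ∈ K.erase o := Finset.mem_erase.2 ⟨by simpa using hwo, hw⟩
      simp [hemp] at this
    · obtain ⟨K', hK', hb'⟩ := exists_comp_balance_nonneg (G := G) col (S := K.erase o) (by omega) hne
      refine step K' hK' fun o' hadj => Or.inl ⟨?_, hb'⟩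
      have := bip _ _ hadj
      cases h : col o' <;> simp_all

end Components

theorem List.exists_last_split {α : Type*} {P : α → Prop} {A : List α} (h : ∃ t ∈ A, P t) :
    ∃ A₁ x A₂, A = A₁ ++ x :: A₂ ∧ P x ∧ ∀ t ∈ A₂, ¬ P t := by
  induction A with
  | nil => simp at h
  | cons a A ih =>
    by_cases hA : ∃ t ∈ A, P t
    · obtain ⟨A₁, x, A₂, rfl, h1, h2⟩ := ih hA
      exact ⟨a :: A₁, x, A₂, rfl, h1, h2⟩
    · push Not at hA
      obtain ⟨t, ht, h3⟩ := h
      rcases List.mem_cons.1 ht with rfl | ht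
      · exact ⟨[], t, A, rfl, h3, hA⟩
      · exact absurd h3 (hA t ht)

/-- A connected set `K` off the cycle `z`, whose neighbours lie in `K` or on the cycle, such that no
nonempty subset of `K` can be separated from the rest of the graph by deleting one vertex. -/
structure Blob {V : Type*} (G : SimpleGraph V) (z : ℤ → V) (K : Finset V) : Prop where
  out : ∀ w ∈ K, ∀ i, w ≠ z i
  closed : ∀ w ∈ K, ∀ v, G.Adj w v → v ∈ K ∨ ∃ i, v = z i
  conn : ConnOn G K
  cut : ∀ U ⊆ K, U.Nonempty → ∀ x, ∃ w ∈ U, ∃ v, v ∉ U ∧ v ≠ x ∧ G.Adj w v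

section Lollipop
variable {V : Type*} {G : SimpleGraph V} {K S' : Finset V} {z : ℤ → V} {w₀ u x x' y d : V}
  {A A₁ A₂ B Q : List V}

/-- The vertices of `K` not in the initial segment `A ++ [x]`. -/
def pathRest (K : Finset V) (A : List V) (x : V) : Finset V := K.filter fun v => v ∉ A ∧ v ≠ x

/-- Every vertex `y` of the component of `u` beyond `A ++ [x]` ends a path starting next to `x`, in
this component, that contains all neighbours of `u` on `Q` outside `A ++ [x]`. -/
def Reroutable (G : SimpleGraph V) (K : Finset V) (u : V) (Q A : List V) (x : V) : Prop :=
  ∀ y ∈ compOf G (pathRest K A x) u, ∃ a σ, G.Adj x a ∧ GPath G (compOf G (pathRest K A x) u) a y σ ∧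
    ∀ t ∈ Q, G.Adj u t → t ∈ σ ∨ t ∈ A ∨ t = x

theorem Reroutable.extend (hP : GPath G (insert w₀ K) w₀ u (w₀ :: Q))
    (e : w₀ :: Q = (A₁ ++ x' :: A₂) ++ x :: B) (hB : B ≠ [])
    (hc : Reroutable G K u Q (A₁ ++ x' :: A₂) x)
    (hy : y ∈ compOf G (pathRest K (A₁ ++ x' :: A₂) x) u) (hadj : G.Adj y x')
    (hA₂ : ∀ t ∈ A₂, ¬ G.Adj u t) : Reroutable G K u Q A₁ x' := by
  set Kg := compOf G (pathRest K (A₁ ++ x' :: A₂) x) u with hKg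
  set K' := compOf G (pathRest K A₁ x') u with hK'
  have hnd := hP.nodup
  rw [e] at hnd
  have hch := hP.chain
  rw [e] at hch
  have huB : u ∈ B := by
    have := hP.last
    rw [e, List.append_cons, List.getLast?_append_of_ne_nil _ hB] at this
    exact List.mem_of_getLast? this
  have huK : u ∈ K := by
    have h1 := hP.sub u hP.last_mem
    rcases Finset.mem_insert.1 h1 with h1 | h1
    · exfalso
      cases A₁ <;> simp_all
    · exact h1
  have hQK : ∀ v ∈ A₂ ++ [x], v ∈ K := by
    intro v hv
    have h1 := hP.sub v (by rw [e]; simp at hv ⊢; tauto)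
    rcases Finset.mem_insert.1 h1 with h1 | h1
    · exfalso
      cases A₁ <;> simp at e hv hnd <;> grind
    · exact h1
  have hu' : u ∈ pathRest K A₁ x' := by
    refine Finset.mem_filter.2 ⟨huK, ?_⟩
    simp [List.nodup_append] at hnd
    grind
  have hu : u ∈ pathRest K (A₁ ++ x' :: A₂) x := by
    refine Finset.mem_filter.2 ⟨huK, ?_⟩
    simp [List.nodup_append] at hnd
    grind
  have hsub : pathRest K (A₁ ++ x' :: A₂) x ⊆ pathRest K A₁ x' := by
    intro v hv
    simp [pathRest] at hv ⊢
    tauto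
  have hKK : Kg ⊆ K' := compOf_mono hsub
  have hcomp' : IsComp G _ K' := isComp_compOf hu'
  have hcomp : IsComp G _ Kg := isComp_compOf hu
  have hKg_out : ∀ v ∈ Kg, v ∉ A₂ ++ [x] := by
    intro v hv h
    have := hcomp.sub hv
    simp [pathRest] at this h
    grind
  obtain ⟨a, σ, ha, hσ, hT⟩ := hc y hy
  obtain ⟨d, hd⟩ : ∃ d, (A₂ ++ [x]).head? = some d := by
    cases A₂ <;> simp
  have hx'd : G.Adj x' d := by
    cases A₂ with
    | nil => simp at hd hch; grind
    | cons b A₂ => simp at hd hch; grind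
  have hDrest : GPath G (pathRest K A₁ x') d x (A₂ ++ [x]) := by
    refine ⟨?_, ?_, ?_, hd, by simp⟩
    · have hch' : ((A₁ ++ [x']) ++ ((A₂ ++ [x]) ++ B)).IsChain G.Adj := by simpa using hch
      exact (List.isChain_append.1 (List.isChain_append.1 hch').2.1).1
    · refine List.Nodup.sublist (l₂ := _) (List.IsInfix.sublist ⟨A₁ ++ [x'], B, by simp⟩) hnd
    · intro v hv
      refine Finset.mem_filter.2 ⟨hQK v hv, ?_⟩
      simp [List.nodup_append] at hnd hv
      grind
  have hD : GPath G K' d x (A₂ ++ [x]) := by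
    have h1 := hDrest.append (hσ.mono fun v hv => hsub (hcomp.sub (hσ.sub v hv))) ha
      (fun v hv hv' => hKg_out v (hσ.sub v hv') hv)
    have h2 := hcomp'.gpath_sub h1 (x := y) (by simp [hσ.last_mem]) (hKK hy)
    exact hDrest.mono fun v hv => h2.sub v (List.mem_append_left _ hv)
  have hback : ∀ q ∈ A₂ ++ [x], ∃ L, GPath G K' y q L ∧ (∀ t ∈ Q, G.Adj u t → t ∈ L ∨ t ∈ A₁ ∨ t = x') ∧
      ∀ v ∈ L, v ∈ Kg ∨ v ∈ A₂ ++ [x] := by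
    intro q hq
    obtain ⟨L₁, L₂, hL⟩ := List.append_of_mem hq
    have h1 := hD.right_of_eq hL (x := q) (by simp)
    have hLx : x ∈ q :: L₂ := h1.last_mem
    refine ⟨σ.reverse ++ (q :: L₂).reverse, ?_, ?_, ?_⟩
    · refine (hσ.reverse.mono fun v hv => hKK (hσ.sub v (by simpa using hv))).append h1.reverse ha.symm ?_
      intro v hv hv'
      refine hKg_out v (hσ.sub v (by simpa using hv)) ?_
      rw [hL]; simp at hv' ⊢; tauto
    · intro t ht hut
      have := hT t ht hut
      have := hA₂ t
      simp at this hLx ⊢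
      grind
    · intro v hv
      rw [hL]
      have := hσ.sub v
      simp at hv ⊢
      tauto
  intro w hw
  by_cases hwg : w ∈ Kg
  · obtain ⟨a', τ, ha', hτ, hT'⟩ := hc w hwg
    refine ⟨d, (A₂ ++ [x]) ++ τ, hx'd, hD.append (hτ.mono fun v hv => hKK (hτ.sub v hv)) ha'
      (fun v hv hv' => hKg_out v (hτ.sub v hv') hv), fun t ht hut => ?_⟩
    have := hT' t ht hut
    simp at this ⊢
    tauto
  by_cases hwA : w ∈ A₂ ++ [x]
  · obtain ⟨L, h1, h2, -⟩ := hback w hwA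
    exact ⟨y, L, hadj.symm, h1, h2⟩
  obtain ⟨τ, hτ⟩ := hcomp'.conn w hw u (mem_compOf_self hu')
  obtain ⟨l₁, v₁, y₁, l₂, e₁, h1, h2, h3, h4⟩ := hτ.exists_first
    (P := fun v => v ∈ Kg ∨ v ∈ A₂ ++ [x]) (by tauto) (Or.inl (mem_compOf_self hu))
  have hv₁ : v₁ ∈ K' := h1.sub v₁ h1.last_mem
  have hn := h2 v₁ h1.last_mem
  have hy₁ : y₁ ∈ A₂ ++ [x] := by
    rcases h3 with h3 | h3
    · refine absurd (Or.inl (hcomp.closed y₁ h3 v₁ ?_ h4.symm)) hn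
      have := hcomp'.sub hv₁
      simp [pathRest] at this hn ⊢
      tauto
    · exact h3
  obtain ⟨L, h5, h6, h7⟩ := hback y₁ hy₁
  refine ⟨y, L ++ l₁.reverse, hadj.symm, h5.append h1.reverse h4.symm ?_, fun t ht hut => ?_⟩
  · intro v hv hv'
    exact h2 v (by simpa using hv') (h7 v hv)
  · have := h6 t ht hut
    simp; tauto

/-- A path of `K` starting next to a vertex of the cycle can be rerouted into an ear containing all
neighbours of its end on the path. -/
theorem Blob.exists_ear (H : Blob G z K) {q₁ : V} {j₀ : ℤ} (hQ : GPath G K q₁ u Q)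
    (hadj : G.Adj q₁ (z j₀)) : ∃ a b l j₁, GPath G K a b l ∧ G.Adj a (z j₀) ∧ G.Adj b (z j₁) ∧
      z j₀ ≠ z j₁ ∧ ∀ t ∈ Q, G.Adj u t → t ∈ l := by
  set w₀ := z j₀ with hw₀
  have hw₀K : w₀ ∉ K := fun h => H.out _ h j₀ rfl
  have hP : GPath G (insert w₀ K) w₀ u (w₀ :: Q) :=
    (hQ.mono fun v hv => Finset.mem_insert_of_mem (hQ.sub v hv)).cons hadj.symm (by simp)
      fun h => hw₀K (hQ.sub _ h)
  have hex : ∃ n, ∃ A x B, w₀ :: Q = A ++ x :: B ∧ B ≠ [] ∧ Reroutable G K u Q A x ∧ A.length = n := by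
    have hne : Q ≠ [] := List.ne_nil_of_mem hQ.last_mem
    obtain ⟨Q', hQ'⟩ : ∃ Q', Q = Q' ++ [u] := by
      refine ⟨Q.dropLast, ?_⟩
      have := hQ.last
      rw [List.getLast?_eq_some_getLast hne] at this
      conv_lhs => rw [← List.dropLast_append_getLast hne]
      simp at this; rw [this]
    obtain ⟨A, x, hA⟩ : ∃ A x, w₀ :: Q' = A ++ [x] :=
      ⟨_, _, (List.dropLast_append_getLast (List.cons_ne_nil w₀ Q')).symm⟩
    have e : w₀ :: Q = A ++ x :: [u] := by
      rw [hQ', ← List.cons_append, hA]; simp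
    refine ⟨_, A, x, [u], e, by simp, ?_, rfl⟩
    have hnd := hP.nodup
    rw [e] at hnd
    have hu : u ∈ pathRest K A x := by
      refine Finset.mem_filter.2 ⟨hQ.sub u hQ.last_mem, ?_⟩
      simp [List.nodup_append] at hnd
      grind
    intro y hy
    obtain ⟨σ, hσ⟩ := (isComp_compOf hu).conn u (mem_compOf_self hu) y hy
    refine ⟨u, σ, ?_, hσ, fun t ht hut => ?_⟩
    · have := hP.chain
      rw [e] at this
      simpa using (List.isChain_append.1 this).2.1
    · have h1 : t ∈ w₀ :: Q := List.mem_cons_of_mem _ ht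
      rw [e] at h1
      have := hut.ne
      simp at h1
      grind
  obtain ⟨A, x, B, e, hB, hc, hlen⟩ := Nat.find_spec hex
  have hmin := fun m => Nat.find_min (H := hex) (m := m)
  have hstep : ∀ A₁ x' A₂ y, A = A₁ ++ x' :: A₂ → y ∈ compOf G (pathRest K A x) u → G.Adj y x' →
      (∀ t ∈ A₂, ¬ G.Adj u t) → False := by
    rintro A₁ x' A₂ y rfl hy hadj hA₂
    have := hc.extend hP e hB hy hadj hA₂
    exact hmin A₁.length (by rw [← hlen]; simp) ⟨A₁, x', A₂ ++ x :: B, by simpa using e, by simp, this, rfl⟩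
  have huB : u ∈ B := by
    have := hP.last
    rw [e, List.append_cons, List.getLast?_append_of_ne_nil _ hB] at this
    exact List.mem_of_getLast? this
  have hnd := hP.nodup
  have hnd' := hP.nodup
  rw [e] at hnd
  have hu : u ∈ pathRest K A x := by
    refine Finset.mem_filter.2 ⟨hQ.sub u hQ.last_mem, ?_⟩
    simp [List.nodup_append] at hnd
    grind
  have hcomp : IsComp G _ (compOf G (pathRest K A x) u) := isComp_compOf hu
  have hfree : ∀ a A', A = a :: A' → ∀ t ∈ A', ¬ G.Adj u t := by
    intro a A' hA
    by_contra! hcon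
    obtain ⟨A₁, x', A₂, rfl, h1, h2⟩ := List.exists_last_split hcon
    exact hstep (a :: A₁) x' A₂ u (by simpa using hA) (mem_compOf_self hu) h1 h2
  obtain ⟨w, hw, v, hv, hvx, hwv⟩ := H.cut _ (hcomp.sub.trans (Finset.filter_subset _ _)) hcomp.nonempty x
  have hwK : w ∈ K := (Finset.filter_subset _ _) (hcomp.sub hw)
  obtain ⟨a, σ, ha, hσ, hT⟩ := hc w hw
  have hσK : GPath G K a w σ := hσ.mono fun t ht => (Finset.filter_subset _ _) (hcomp.sub (hσ.sub t ht))
  rcases H.closed w hwK v hwv with hvK | ⟨j, rfl⟩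
  · have hvA : v ∈ A := by
      by_contra hvA
      exact hv (hcomp.closed w hw v (Finset.mem_filter.2 ⟨hvK, hvA, hvx⟩) hwv)
    obtain ⟨A₁, A₂, hA⟩ := List.append_of_mem hvA
    refine (hstep A₁ v A₂ w hA hw hwv fun t ht => ?_).elim
    cases A₁ with
    | nil =>
      rw [hA] at e
      simp at e
      exact absurd (e.1 ▸ hvK) hw₀K
    | cons a A₁ => exact hfree a _ hA t (by simp [ht])
  · cases A with
    | nil =>
      simp at e
      obtain ⟨rfl, rfl⟩ := e
      refine ⟨a, w, σ, j, hσK, ha.symm, hwv, fun h => hvx h.symm, fun t ht hut => ?_⟩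
      have := hT t ht hut
      simp at this
      rcases this with h | h
      · exact h
      · exact absurd (h ▸ hQ.sub t ht) hw₀K
    | cons a₀ A' =>
      simp at e
      obtain ⟨rfl, rfl⟩ := e
      by_cases hjj : w₀ = z j
      · exact (hstep [] w₀ A' w rfl hw (hjj ▸ hwv) (hfree _ _ rfl)).elim
      have h1 := hQ.left_of_eq (l₁ := A' ++ [x]) (l₂ := B) (x := x) (by simp) (by simp)
      refine ⟨q₁, w, (A' ++ [x]) ++ σ, j, h1.append hσK ha ?_, hadj, hwv, hjj, fun t ht hut => ?_⟩
      · intro t ht ht'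
        have := hcomp.sub (hσ.sub t ht')
        simp [pathRest] at this ht
        tauto
      · have := hT t ht hut
        have hne : t ≠ w₀ := fun h => hw₀K (h ▸ hQ.sub t ht)
        simp [hne] at this ⊢
        tauto
end Lollipop

theorem Nat.exists_max_of_le {P : ℕ → Prop} (h : ∃ n, P n) (b : ℕ) (hb : ∀ n, P n → n ≤ b) :
    ∃ n, P n ∧ ∀ m, P m → m ≤ n := by
  obtain ⟨n, hn⟩ := h
  exact ⟨Nat.findGreatest P b, Nat.findGreatest_spec (hb n hn) hn,
    fun m hm => Nat.le_findGreatest (hb m hm) hm⟩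

section Counting
variable {V : Type*} {G : SimpleGraph V} {S : Finset V} {a b : V} {l : List V} {col : V → Bool}

theorem GPath.two_mul_card_le (h : GPath G S a b l) (bip : ∀ u v, G.Adj u v → col u ≠ col v)
    {N : Finset V} {κ : Bool} (hN : ∀ t ∈ N, t ∈ l ∧ col t = κ) :
    2 * N.card + 1 ≤ l.length + (if col a = κ then 1 else 0) + (if col b = κ then 1 else 0) := by
  have h1 := h.two_mul_countP bip κ
  have h2 : N.card ≤ l.countP fun v => col v == κ := by
    rw [List.countP_eq_length_filter, ← List.toFinset_card_of_nodup (h.nodup.filter _)]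
    refine Finset.card_le_card fun t ht => ?_
    have := hN t ht
    simpa using this
  omega

theorem GPath.length_le_card (h : GPath G S a b l) : l.length ≤ S.card := by
  rw [← List.toFinset_card_of_nodup h.nodup]
  exact Finset.card_le_card fun t ht => h.sub t (by simpa using ht)

end Counting

/-- The number of neighbours of `u` in `W`. -/
def outDegree {V : Type*} (G : SimpleGraph V) (W : Finset V) (u : V) : ℕ :=
  (W.filter fun v => G.Adj u v).card

/-- The situation at a minimal counterexample: `W` is the set of vertices off the longest cycle,
degree sums of vertices of different colours in `W` are large, and nothing can be cut off. -/
structure OutSetup {V : Type*} [Fintype V] (G : SimpleGraph V) (col : V → Bool) (c : ℕ) (z : ℤ → V)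
    (W : Finset V) : Prop where
  cyc : CycleSetup G col c z
  out : ∀ w ∈ W, ∀ i, w ≠ z i
  closed : ∀ w ∈ W, ∀ v, G.Adj w v → v ∈ W ∨ ∃ i, v = z i
  pair : ∀ u ∈ W, ∀ v ∈ W, col u ≠ col v → c + 2 + (if G.Adj u v then 1 else 0) ≤
    cycleDegree G z u + outDegree G W u + (cycleDegree G z v + outDegree G W v)
  cut : ∀ U ⊆ W, U.Nonempty → ∀ x, ∃ w ∈ U, ∃ v, v ∉ U ∧ v ≠ x ∧ G.Adj w v

/-- A path in `K` whose ends are attached to two different vertices of the cycle. -/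
structure IsEar {V : Type*} (G : SimpleGraph V) (z : ℤ → V) (K : Finset V) (a b : V) (l : List V) :
    Prop where
  path : GPath G K a b l
  att : ∃ i j, G.Adj a (z i) ∧ G.Adj b (z j) ∧ z i ≠ z j

/-- A longest ear of a component `K` of `W`. -/
structure LongEar {V : Type*} [Fintype V] (G : SimpleGraph V) (col : V → Bool) (c : ℕ) (z : ℤ → V)
    (W K : Finset V) (a b : V) (l : List V) : Prop where
  setup : OutSetup G col c z W
  comp : IsComp G W K
  ear : IsEar G z K a b l
  max : ∀ a' b' l', IsEar G z K a' b' l' → l'.length ≤ l.length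

section Swap
variable {V : Type*} [Fintype V] {G : SimpleGraph V} {col : V → Bool} {c : ℕ} {z : ℤ → V}
  {W K : Finset V} {a b : V} {l : List V}

theorem OutSetup.swap (h : OutSetup G col c z W) :
    OutSetup G (fun v => !col v) c (fun i => z (i + 1)) W where
  cyc := h.cyc.swap
  out w hw i := h.out w hw (i + 1)
  closed w hw v hv := (h.closed w hw v hv).imp id fun ⟨i, hi⟩ => ⟨i - 1, by rw [hi]; congr 1; ring⟩
  pair u hu v hv huv := by
    simp only [cycleDegree_shift]
    exact h.pair u hu v hv (by simpa using huv)
  cut := h.cut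

theorem isEar_shift : IsEar G (fun i => z (i + 1)) K a b l ↔ IsEar G z K a b l := by
  constructor
  · rintro ⟨h, i, j, h1⟩
    exact ⟨h, i + 1, j + 1, h1⟩
  · rintro ⟨h, i, j, h1⟩
    exact ⟨h, i - 1, j - 1, by simpa using h1⟩

theorem LongEar.swap (h : LongEar G col c z W K a b l) :
    LongEar G (fun v => !col v) c (fun i => z (i + 1)) W K a b l where
  setup := h.setup.swap
  comp := h.comp
  ear := isEar_shift.2 h.ear
  max a' b' l' h' := h.max a' b' l' (isEar_shift.1 h')

theorem IsEar.reverse (h : IsEar G z K a b l) : IsEar G z K b a l.reverse := by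
  obtain ⟨h, i, j, h1, h2, h3⟩ := h
  exact ⟨h.reverse, j, i, h2, h1, h3.symm⟩

theorem LongEar.reverse (h : LongEar G col c z W K a b l) :
    LongEar G col c z W K b a l.reverse where
  setup := h.setup
  comp := h.comp
  ear := h.ear.reverse
  max a' b' l' h' := by simpa using h.max a' b' l' h'

theorem OutSetup.blob (h : OutSetup G col c z W) (hK : IsComp G W K) : Blob G z K where
  out w hw := h.out w (hK.sub hw)
  closed w hw v hv := (h.closed w (hK.sub hw) v hv).imp (fun h1 => hK.closed w hw v h1 hv) id
  conn := hK.conn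
  cut U hU := h.cut U (hU.trans hK.sub)

theorem OutSetup.exists_longEar (h : OutSetup G col c z W) (hK : IsComp G W K) :
    ∃ a b l, LongEar G col c z W K a b l := by
  have H := h.blob hK
  have hex : ∃ n, ∃ a b l, IsEar G z K a b l ∧ l.length = n := by
    obtain ⟨w, hw, v, hv, -, hwv⟩ := H.cut K subset_rfl hK.nonempty (hK.nonempty.choose)
    obtain ⟨i, rfl⟩ := (H.closed w hw v hwv).resolve_left hv
    obtain ⟨a, b, l, j, h1, h2, h3, h4, -⟩ := H.exists_ear (GPath.single (G := G) hw) hwv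
    exact ⟨_, a, b, l, ⟨h1, i, j, h2, h3, h4⟩, rfl⟩
  obtain ⟨n, ⟨a, b, l, h1, rfl⟩, h2⟩ := Nat.exists_max_of_le hex K.card (by
    rintro n ⟨a, b, l, h1, rfl⟩
    exact h1.path.length_le_card)
  exact ⟨a, b, l, h, hK, h1, fun a' b' l' h' => h2 _ ⟨a', b', l', h', rfl⟩⟩

end Swap

namespace LongEar
variable {V : Type*} [Fintype V] {G : SimpleGraph V} {col : V → Bool} {c : ℕ} {z : ℤ → V}
  {W K : Finset V} {a b u v : V} {l : List V}

theorem pathW (h : LongEar G col c z W K a b l) : GPath G W a b l :=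
  h.ear.path.mono fun x hx => h.comp.sub (h.ear.path.sub x hx)

theorem length_lt (h : LongEar G col c z W K a b l) : l.length + 1 ≤ c := by
  obtain ⟨i, j, h1, h2, h3⟩ := h.ear.att
  exact h.setup.cyc.length_ear_lt h.setup.out h.pathW h1 h2 h3

theorem ends_mem (h : LongEar G col c z W K a b l) : a ∈ K ∧ b ∈ K :=
  ⟨h.ear.path.sub _ h.ear.path.head_mem, h.ear.path.sub _ h.ear.path.last_mem⟩

theorem col_ne (h : LongEar G col c z W K a b l) {u v : V} (huv : G.Adj u v) : col v = !col u := by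
  have := h.setup.cyc.bip u v huv
  cases h1 : col u <;> cases h2 : col v <;> simp_all

/-- Twice the number of neighbours in `W` of an end of an ear that lie on the ear. -/
theorem two_mul_card_nbrs_le (h : LongEar G col c z W K a b l) {N : Finset V}
    (hN : ∀ t ∈ N, G.Adj u t ∧ t ∈ l) : 2 * N.card + 1 ≤ l.length +
      (if col a = col u then 0 else 1) + (if col b = col u then 0 else 1) := by
  have := h.ear.path.two_mul_card_le h.setup.cyc.bip (N := N) (κ := !col u)
    fun t ht => ⟨(hN t ht).2, h.col_ne (hN t ht).1⟩
  cases h1 : col a <;> cases h2 : col b <;> cases h3 : col u <;> simp_all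

/-- Every neighbour in `W` of the vertex `u` lies on `l`. -/
def Closed (G : SimpleGraph V) (W : Finset V) (l : List V) (u : V) : Prop :=
  ∀ t ∈ W, G.Adj u t → t ∈ l

theorem two_mul_outDegree_le (h : LongEar G col c z W K a b l) (hu : Closed G W l u) :
    2 * outDegree G W u + 1 ≤ l.length +
      (if col a = col u then 0 else 1) + (if col b = col u then 0 else 1) :=
  h.two_mul_card_nbrs_le fun t ht => by
    have := Finset.mem_filter.1 ht
    exact ⟨this.2, hu t this.1 this.2⟩

theorem exists_small (h : LongEar G col c z W K a b l) (hb : ¬ Closed G W l b) :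
    ∃ v ∈ K, v ∉ l ∧ cycleDegree G z v + outDegree G W v ≤ l.length / 2 + 1 := by
  unfold Closed at hb
  push Not at hb
  obtain ⟨y, hyW, hby, hyl⟩ := hb
  obtain ⟨i, j, hi, hj, hij⟩ := h.ear.att
  have hp := h.ear.path
  have hbK := h.ends_mem.2
  have hyK := h.comp.closed b hbK y hyW hby
  obtain ⟨n, ⟨Q, v, hQ, rfl⟩, hmax⟩ := Nat.exists_max_of_le
    (P := fun n => ∃ Q v, GPath G K a v (l ++ Q) ∧ Q.length = n) ⟨1, [y], y, hp.concat hby hyK hyl, rfl⟩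
    K.card (by rintro n ⟨Q, v, hQ, rfl⟩; have := hQ.length_le_card; simp at this; omega)
  have hQne : Q ≠ [] := by
    rintro rfl
    have := hmax 1 ⟨[y], y, hp.concat hby hyK hyl, rfl⟩
    simp at this
  have hvQ : v ∈ Q := by
    have := hQ.last
    rw [List.getLast?_append_of_ne_nil _ hQne] at this
    exact List.mem_of_getLast? this
  have hvK : v ∈ K := hQ.sub v hQ.last_mem
  have hN : ∀ t ∈ W, G.Adj v t → t ∈ l ++ Q := by
    intro t ht hvt
    by_contra hcon
    have := hmax (Q.length + 1) ⟨Q ++ [t], t, by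
      rw [← List.append_assoc]
      exact hQ.concat hvt (h.comp.closed v hvK t ht hvt) hcon, by simp⟩
    omega
  have hC : ∀ k, G.Adj v (z k) → z k = z i := by
    intro k hk
    by_contra hne
    have := h.max a v _ ⟨hQ, i, k, hi, hk, fun h => hne h.symm⟩
    have h1 := List.length_pos_iff.2 hQne
    rw [List.length_append] at this
    omega
  have hd := h.setup.cyc.cycleDegree_le_one hC
  refine ⟨v, hvK, fun hvl => ?_, ?_⟩
  · exact (List.nodup_append.1 hQ.nodup).2.2 v hvl v hvQ rfl
  obtain ⟨a', b', l', k, h1, h2, h3, h4, h5⟩ := (h.setup.blob h.comp).exists_ear hQ hi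
  have hlen := h.max a' b' l' ⟨h1, i, k, h2, h3, h4⟩
  have hcnt := h1.two_mul_card_le h.setup.cyc.bip (N := W.filter fun t => G.Adj v t) (κ := !col v)
    fun t ht => by
      have := Finset.mem_filter.1 ht
      exact ⟨h5 t (hN t this.1 this.2) this.2, h.col_ne this.2⟩
  rw [outDegree]
  by_cases hvi : 1 ≤ cycleDegree G z v
  · obtain ⟨k', hk'⟩ := CycleSetup.exists_adj_of_cycleDegree_pos (G := G) (z := z) v hvi
    rw [hC k' hk'] at hk'
    have e : col a' = col v := by
      have e1 := h.col_ne hk'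
      have e2 := h.col_ne h2
      rw [e1] at e2
      simpa using e2.symm
    rw [if_neg (by rw [e]; simp)] at hcnt
    split_ifs at hcnt <;> omega
  · split_ifs at hcnt <;> omega

theorem not_small_of_closed (h : LongEar G col c z W K a b l) (ha : Closed G W l a) (hv : v ∈ W)
    (hc : col v ≠ col a) (hs : cycleDegree G z v + outDegree G W v ≤ l.length / 2 + 1) : False := by
  have h1 := h.setup.pair a (h.comp.sub h.ends_mem.1) v hv hc.symm
  have h2 := h.two_mul_outDegree_le ha
  have h3 := h.length_lt
  obtain ⟨i, j, hi, hj, hij⟩ := h.ear.att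
  have h5 := h.setup.cyc.cycleDegree_pos hj
  rw [if_pos rfl] at h2
  by_cases hab : col b = col a
  · rw [if_pos hab] at h2
    by_cases hA : 2 ≤ cycleDegree G z a
    · have h4 := h.setup.cyc.cycleDegree_add_length_le h.setup.out h.pathW hj hA
      omega
    · omega
  · rw [if_neg hab] at h2
    have h4 := h.setup.cyc.cycleDegree_add_cycleDegree_add_length_le h.setup.out h.pathW
      (fun e => hab e.symm) (h.setup.cyc.cycleDegree_pos hi) h5
    omega

theorem col_eq_of_closed (h : LongEar G col c z W K a b l) (ha : Closed G W l a)
    (hb : Closed G W l b) : col a = col b := by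
  by_contra hab
  have h1 := h.setup.pair a (h.comp.sub h.ends_mem.1) b (h.comp.sub h.ends_mem.2) hab
  have h2 := h.two_mul_outDegree_le ha
  have h3 := h.two_mul_outDegree_le hb
  obtain ⟨i, j, hi, hj, hij⟩ := h.ear.att
  have h4 := h.setup.cyc.cycleDegree_add_cycleDegree_add_length_le h.setup.out h.pathW hab
    (h.setup.cyc.cycleDegree_pos hi) (h.setup.cyc.cycleDegree_pos hj)
  rw [if_pos rfl, if_neg fun e => hab e.symm] at h2
  rw [if_pos rfl, if_neg hab] at h3
  omega

end LongEar

theorem Finset.two_mul_card_le_of_parity {S : Finset ℕ} {α β : ℕ} (hS : ∀ x ∈ S, α ≤ x ∧ x ≤ β)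
    (hp : ∀ x ∈ S, ∀ y ∈ S, x % 2 = y % 2) : 2 * S.card ≤ β + 2 - α := by
  rcases S.eq_empty_or_nonempty with rfl | ⟨x₀, hx₀⟩
  · simp
  have h1 : S.card ≤ (Finset.range ((β - α) / 2 + 1)).card := by
    refine Finset.card_le_card_of_injOn (fun x => (x - α) / 2) (fun x hx => ?_) fun x hx y hy e => ?_
    · have := hS x hx
      simp only [Finset.coe_range, Set.mem_Iio]
      omega
    · have h1 := hS x hx
      have h2 := hS y hy
      have h3 := hp x hx y hy
      simp only at e
      omega
  rw [Finset.card_range] at h1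
  have := hS x₀ hx₀
  omega

theorem GPath.col_getElem {V : Type*} {G : SimpleGraph V} {S : Finset V} {a b : V} {l : List V}
    {col : V → Bool} (h : GPath G S a b l) (bip : ∀ u v, G.Adj u v → col u ≠ col v) {i : ℕ}
    (hi : i < l.length) : col l[i] = if i % 2 = 0 then col a else !col a := by
  induction i with
  | zero => simp [h.getElem_zero]
  | succ i ih =>
    have h1 := bip _ _ (h.adj_getElem hi)
    have h2 := ih (by omega)
    rcases Nat.mod_two_eq_zero_or_one i with h3 | h3
    · have h4 : (i + 1) % 2 = 1 := by omega
      simp [h3, h4] at h2 ⊢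
      rw [h2] at h1
      cases h5 : col l[i + 1] <;> cases h6 : col a <;> simp_all
    · have h4 : (i + 1) % 2 = 0 := by omega
      simp [h3, h4] at h2 ⊢
      rw [h2] at h1
      cases h5 : col l[i + 1] <;> cases h6 : col a <;> simp_all

/-- A path `Q` of `K` off the path `l`, from a vertex `o` adjacent to `l[j]` to a vertex `u` all of
whose neighbours in `W` lie on `l`, on `Q` or in `R`. -/
structure Region {V : Type*} (G : SimpleGraph V) (W K : Finset V) (l : List V) (R : Finset V)
    (o u : V) (Q : List V) (j : ℕ) : Prop where
  path : GPath G K o u Q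
  disj : ∀ x ∈ Q, x ∉ l
  adj : ∃ hj : j < l.length, G.Adj l[j] o
  nbrs : ∀ w ∈ W, G.Adj u w → w ∈ l ∨ w ∈ Q ∨ w ∈ R

namespace Region
variable {V : Type*} [Fintype V] {G : SimpleGraph V} {col : V → Bool} {c : ℕ} {z : ℤ → V}
  {W K R : Finset V} {a b u o : V} {l Q : List V} {j : ℕ}

theorem path_left (hR : Region G W K l R o u Q j) (h : LongEar G col c z W K a b l) {i : ℕ}
    (hi : i < l.length) (hu : G.Adj u l[i]) : GPath G K a u (l.take (i + 1) ++ [u]) :=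
  (h.ear.path.take_getElem hi).concat hu.symm (hR.path.sub _ hR.path.last_mem)
    fun hm => hR.disj _ hR.path.last_mem (List.mem_of_mem_take hm)

theorem path_right (hR : Region G W K l R o u Q j) (h : LongEar G col c z W K a b l) {i : ℕ}
    (hi : i < l.length) (hu : G.Adj u l[i]) : GPath G K b u ((l.drop i).reverse ++ [u]) :=
  (h.ear.path.drop_getElem hi).reverse.concat hu.symm (hR.path.sub _ hR.path.last_mem)
    fun hm => hR.disj _ hR.path.last_mem (List.mem_of_mem_drop (by simpa using hm))

theorem tail_left (hR : Region G W K l R o u Q j) (h : LongEar G col c z W K a b l) :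
    GPath G K a u (l.take (j + 1) ++ Q) := by
  obtain ⟨hj, hadj⟩ := hR.adj
  exact (h.ear.path.take_getElem hj).append hR.path hadj
    fun x hx hx' => hR.disj x hx' (List.mem_of_mem_take hx)

theorem tail_right (hR : Region G W K l R o u Q j) (h : LongEar G col c z W K a b l) :
    GPath G K b u ((l.drop j).reverse ++ Q) := by
  obtain ⟨hj, hadj⟩ := hR.adj
  exact (h.ear.path.drop_getElem hj).reverse.append hR.path hadj
    fun x hx hx' => hR.disj x hx' (List.mem_of_mem_drop (by simpa using hx))

theorem le_of_lt (hR : Region G W K l R o u Q j) (h : LongEar G col c z W K a b l) {i : ℕ}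
    (hi : i < l.length) (hu : G.Adj u l[i]) (hij : i < j) : i + 1 + Q.length ≤ j := by
  obtain ⟨hj, hadj⟩ := hR.adj
  have h1 := ((h.ear.path.take_getElem hi).append hR.path.reverse hu.symm
    fun x hx hx' => hR.disj x (by simpa using hx') (List.mem_of_mem_take hx)).append
      (h.ear.path.drop_getElem hj) hadj.symm (by
        intro x hx hx'
        rcases List.mem_append.1 hx with hx | hx
        · exact List.disjoint_take_drop h.ear.path.nodup (show i + 1 ≤ j by omega) hx hx'
        · exact hR.disj x (by simpa using hx) (List.mem_of_mem_drop hx'))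
  have := h.max _ _ _ ⟨h1, h.ear.att⟩
  simp at this
  omega

theorem le_of_gt (hR : Region G W K l R o u Q j) (h : LongEar G col c z W K a b l) {i : ℕ}
    (hi : i < l.length) (hu : G.Adj u l[i]) (hij : j < i) : j + 1 + Q.length ≤ i := by
  obtain ⟨hj, hadj⟩ := hR.adj
  have h1 := (hR.tail_left h).append (h.ear.path.drop_getElem hi) hu (by
        intro x hx hx'
        rcases List.mem_append.1 hx with hx | hx
        · exact List.disjoint_take_drop h.ear.path.nodup (show j + 1 ≤ i by omega) hx hx'
        · exact hR.disj x (by simpa using hx) (List.mem_of_mem_drop hx'))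
  have := h.max _ _ _ ⟨h1, h.ear.att⟩
  simp at this
  omega

/-- Rerouting the longest ear bounds the number of neighbours of `u` by the length of a path from
the cycle that contains them. -/
theorem two_mul_card_le_of_tail (h : LongEar G col c z W K a b l) {L : List V} {x : V} {i : ℤ}
    (hL : GPath G K x u L) (hx : G.Adj x (z i)) {N : Finset V} (hN : ∀ t ∈ N, G.Adj u t ∧ t ∈ L) :
    2 * N.card ≤ l.length + 1 := by
  obtain ⟨a', b', l', k, h1, h2, h3, h4, h5⟩ := (h.setup.blob h.comp).exists_ear hL hx
  have hlen := h.max a' b' l' ⟨h1, i, k, h2, h3, h4⟩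
  have hcnt := h1.two_mul_card_le h.setup.cyc.bip (N := N) (κ := !col u)
    fun t ht => ⟨h5 t (hN t ht).2 (hN t ht).1, h.col_ne (hN t ht).1⟩
  split_ifs at hcnt <;> omega

theorem main (hR : Region G W K l R o u Q j) (h : LongEar G col c z W K a b l) :
    2 * ((W.filter fun v => G.Adj u v) \ R).card ≤ l.length + 1 ∧ ∃ l₀ l₁, GPath G K a u l₀ ∧
      GPath G K b u l₁ ∧
        2 * ((W.filter fun v => G.Adj u v) \ R).card + l.length + 1 ≤ l₀.length + l₁.length := by
  obtain ⟨hj, hadj⟩ := hR.adj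
  obtain ⟨i₀, i₁, hi₀, hi₁, -⟩ := h.ear.att
  set N := (W.filter fun v => G.Adj u v) \ R with hN
  set NQ := N.filter fun v => v ∈ Q with hNQ
  set I := (Finset.range l.length).filter fun i => ∃ hi : i < l.length, G.Adj u l[i] with hI
  have hIm : ∀ i ∈ I, ∃ hi : i < l.length, G.Adj u l[i] := fun i hi => (Finset.mem_filter.1 hi).2
  have hNm : ∀ t ∈ N, G.Adj u t ∧ (t ∈ l ∨ t ∈ Q) := by
    intro t ht
    simp only [hN, Finset.mem_sdiff, Finset.mem_filter] at ht
    have := hR.nbrs t ht.1.1 ht.1.2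
    tauto
  have hδ : N.card ≤ I.card + NQ.card := by
    have h1 : NQ.card + (N.filter fun v => v ∉ Q).card = N.card := by
      rw [hNQ]
      exact Finset.card_filter_add_card_filter_not _
    have h2 : (N.filter fun v => v ∉ Q).card ≤ I.card := by
      refine Finset.card_le_card_of_injOn (fun t => l.idxOf t) (fun t ht => ?_) fun t ht t' ht' e => ?_
      · have ht := Finset.mem_filter.1 ht
        have h3 := hNm t ht.1
        have h4 : t ∈ l := by tauto
        have h5 := List.idxOf_lt_length_of_mem h4
        simp only [hI, Finset.coe_filter, Finset.mem_range, Set.mem_ofPred_eq]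
        exact ⟨h5, h5, by simpa using h3.1⟩
      · have ht := Finset.mem_filter.1 ht
        have h3 := hNm t ht.1
        exact (List.idxOf_inj (by tauto)).1 e
    omega
  have hρ := hR.path.two_mul_card_le h.setup.cyc.bip (N := NQ) (κ := !col u) fun t ht => by
    have ht := Finset.mem_filter.1 ht
    exact ⟨ht.2, h.col_ne (hNm t ht.1).1⟩
  rw [if_neg (c := col u = !col u) (by simp)] at hρ
  have hq := hR.path.length_pos
  have hjI : j ∈ I → 2 * NQ.card + 1 ≤ Q.length := by
    intro hjI
    obtain ⟨_, h1⟩ := hIm j hjI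
    have e : col o = col u := by
      have e1 := h.col_ne h1
      have e2 := h.col_ne hadj
      rw [e1] at e2
      simpa using e2
    rw [if_neg (by rw [e]; simp)] at hρ
    omega
  have hρ' : 2 * NQ.card ≤ Q.length := by split_ifs at hρ <;> omega
  have hpar : ∀ i ∈ I, ∀ i' ∈ I, i % 2 = i' % 2 := by
    intro i hi i' hi'
    obtain ⟨hi, h1⟩ := hIm i hi
    obtain ⟨hi', h2⟩ := hIm i' hi'
    have e1 := h.col_ne h1
    have e2 := h.col_ne h2
    rw [h.ear.path.col_getElem h.setup.cyc.bip] at e1 e2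
    rw [← e2] at e1
    by_contra hne
    rcases Nat.mod_two_eq_zero_or_one i with h3 | h3 <;>
    rcases Nat.mod_two_eq_zero_or_one i' with h4 | h4 <;> simp_all
  have hsplit : I.card ≤ (I.filter fun i => i < j).card + (I.filter fun i => j < i).card +
      (if j ∈ I then 1 else 0) := by
    have h1 : I ⊆ ((I.filter fun i => i < j) ∪ (I.filter fun i => j < i)) ∪ (if j ∈ I then {j} else ∅) := by
      intro i hi
      rcases lt_trichotomy i j with h1 | h1 | h1
      · exact Finset.mem_union_left _ (Finset.mem_union_left _ (Finset.mem_filter.2 ⟨hi, h1⟩))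
      · rw [h1] at hi ⊢
        exact Finset.mem_union_right _ (by rw [if_pos hi]; exact Finset.mem_singleton_self _)
      · exact Finset.mem_union_left _ (Finset.mem_union_right _ (Finset.mem_filter.2 ⟨hi, h1⟩))
    refine (Finset.card_le_card h1).trans ((Finset.card_union_le _ _).trans ?_)
    gcongr
    · exact Finset.card_union_le _ _
    · split_ifs <;> simp
  have htl := hR.tail_left h
  have htr := hR.tail_right h
  have hLl : (l.take (j + 1) ++ Q).length = j + 1 + Q.length := by simp; omega
  have hLr : ((l.drop j).reverse ++ Q).length = l.length - j + Q.length := by simp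
  have hleft : (I.filter fun i => i < j) = ∅ ∨ ∃ m, ∃ hm : m < l.length, G.Adj u l[m] ∧ m < j ∧
      2 * (I.filter fun i => i < j).card + Q.length + m ≤ j + 1 := by
    rcases (I.filter fun i => i < j).eq_empty_or_nonempty with h1 | h1
    · exact Or.inl h1
    have h2 := Finset.mem_filter.1 (Finset.min'_mem _ h1)
    set m := (I.filter fun i => i < j).min' h1 with hm
    obtain ⟨h3, h4⟩ := hIm m h2.1
    refine Or.inr ⟨m, h3, h4, h2.2, ?_⟩
    have h5 := Finset.two_mul_card_le_of_parity (S := I.filter fun i => i < j) (α := m)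
      (β := j - 1 - Q.length) (fun x hx => ⟨Finset.min'_le _ _ hx, by
        have hx := Finset.mem_filter.1 hx
        obtain ⟨hx1, hx2⟩ := hIm x hx.1
        have := hR.le_of_lt h hx1 hx2 hx.2
        omega⟩) fun x hx y hy => hpar x (Finset.mem_filter.1 hx).1 y (Finset.mem_filter.1 hy).1
    have h6 := hR.le_of_lt h h3 h4 h2.2
    omega
  have hright : (I.filter fun i => j < i) = ∅ ∨ ∃ m, ∃ hm : m < l.length, G.Adj u l[m] ∧ j < m ∧
      2 * (I.filter fun i => j < i).card + Q.length + j ≤ m + 1 := by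
    rcases (I.filter fun i => j < i).eq_empty_or_nonempty with h1 | h1
    · exact Or.inl h1
    have h2 := Finset.mem_filter.1 (Finset.max'_mem _ h1)
    set m := (I.filter fun i => j < i).max' h1 with hm
    obtain ⟨h3, h4⟩ := hIm m h2.1
    refine Or.inr ⟨m, h3, h4, h2.2, ?_⟩
    have h5 := Finset.two_mul_card_le_of_parity (S := I.filter fun i => j < i) (α := j + 1 + Q.length)
      (β := m) (fun x hx => ⟨by
        have hx := Finset.mem_filter.1 hx
        obtain ⟨hx1, hx2⟩ := hIm x hx.1
        have := hR.le_of_gt h hx1 hx2 hx.2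
        omega, Finset.le_max' _ _ hx⟩)
        fun x hx y hy => hpar x (Finset.mem_filter.1 hx).1 y (Finset.mem_filter.1 hy).1
    have h6 := hR.le_of_gt h h3 h4 h2.2
    omega
  have hnotl : ∀ t ∈ N, ∀ hi : l.idxOf t < l.length, t ∈ l → l.idxOf t ∈ I := by
    intro t ht hi hl
    simp only [hI, Finset.mem_filter, Finset.mem_range]
    exact ⟨hi, hi, by simpa using (hNm t ht).1⟩
  have hone : ((I.filter fun i => j < i) = ∅ ∨ (I.filter fun i => i < j) = ∅) →
      2 * N.card ≤ l.length + 1 := by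
    rintro (h0 | h0)
    · refine two_mul_card_le_of_tail h htl hi₀ fun t ht => ⟨(hNm t ht).1, ?_⟩
      rcases (hNm t ht).2 with h1 | h1
      · have h2 := List.idxOf_lt_length_of_mem h1
        have h3 : ¬ j < l.idxOf t := fun h3 =>
          Finset.eq_empty_iff_forall_notMem.1 h0 _ (Finset.mem_filter.2 ⟨hnotl t ht h2 h1, h3⟩)
        refine List.mem_append_left _ (List.mem_take_iff_getElem.2 ⟨l.idxOf t, by omega, by simp⟩)
      · exact List.mem_append_right _ h1
    · refine two_mul_card_le_of_tail h htr hi₁ fun t ht => ⟨(hNm t ht).1, ?_⟩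
      rcases (hNm t ht).2 with h1 | h1
      · have h2 := List.idxOf_lt_length_of_mem h1
        have h3 : ¬ l.idxOf t < j := fun h3 =>
          Finset.eq_empty_iff_forall_notMem.1 h0 _ (Finset.mem_filter.2 ⟨hnotl t ht h2 h1, h3⟩)
        refine List.mem_append_left _ (List.mem_reverse.2 (List.mem_drop_iff_getElem.2
          ⟨l.idxOf t - j, by omega, ?_⟩))
        have e : j + (l.idxOf t - j) = l.idxOf t := by omega
        simp [e]
      · exact List.mem_append_right _ h1
  have hlenl : ∀ m, m < l.length → (l.take (m + 1) ++ [u]).length = m + 2 := by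
    intro m hm; simp; omega
  have hlenr : ∀ m, ((l.drop m).reverse ++ [u]).length = l.length - m + 1 := by
    intro m; simp
  rcases hleft with h1 | ⟨m, hm, hum, hmj, h1⟩ <;> rcases hright with h2 | ⟨M, hM, huM, hMj, h2⟩
  · refine ⟨hone (Or.inl h2), _, _, htl, htr, ?_⟩
    rw [hLl, hLr]
    rw [h1, h2] at hsplit
    simp only [Finset.card_empty] at hsplit
    split_ifs at hsplit with h3
    · have := hjI h3; omega
    · omega
  · refine ⟨hone (Or.inr h1), _, _, hR.path_left h hM huM, htr, ?_⟩
    rw [hlenl M hM, hLr]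
    rw [h1] at hsplit
    simp only [Finset.card_empty] at hsplit
    split_ifs at hsplit with h3
    · have := hjI h3; omega
    · omega
  · refine ⟨hone (Or.inl h2), _, _, htl, hR.path_right h hm hum, ?_⟩
    rw [hlenr m, hLl]
    rw [h2] at hsplit
    simp only [Finset.card_empty] at hsplit
    split_ifs at hsplit with h3
    · have := hjI h3; omega
    · omega
  · have key : 2 * N.card + m ≤ M + 2 := by
      split_ifs at hsplit with h3
      · have := hjI h3; omega
      · omega
    refine ⟨by omega, _, _, hR.path_left h hM huM, hR.path_right h hm hum, ?_⟩
    rw [hlenl M hM, hlenr m]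
    omega

end Region

namespace LongEar
variable {V : Type*} [Fintype V] {G : SimpleGraph V} {col : V → Bool} {c : ℕ} {z : ℤ → V}
  {W K K' R : Finset V} {a b u v o : V} {l Q : List V} {j : ℕ}

/-- The vertices of `K` off the path `l` and outside `R`. -/
def offEar (K : Finset V) (l : List V) (R : Finset V) : Finset V := K.filter fun x => x ∉ l ∧ x ∉ R

/-- A path from `o` into a component `K'` of the complement of an ear, continued to a vertex with
all neighbours on the path. -/
theorem region_of_root (h : LongEar G col c z W K a b l) (hK' : IsComp G (offEar K l R) K')
    {p y : V} {L : List V} (hp : p ∈ l) (hpy : G.Adj p y)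
    (hL : L = [] ∧ y = o ∨ ∃ v₂, GPath G K y v₂ L ∧ G.Adj v₂ o ∧ ∀ x ∈ L, x ∉ l ∧ x ∉ K') (ho : o ∈ K')
    (hb : col o = false ∧ 0 ≤ balance col K' ∨ col o = true ∧ 1 ≤ balance col K') :
    ∃ y u Q j, col u = true ∧ u ∈ K ∧ Region G W K l R y u Q j := by
  obtain ⟨u, Q, hu, hQ, hN⟩ := exists_path_containing_neighbors h.setup.cyc.bip hK'.conn ho hb
  have hoff : ∀ x ∈ K', x ∈ K ∧ x ∉ l ∧ x ∉ R := fun x hx => Finset.mem_filter.1 (hK'.sub hx)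
  have huK := hQ.sub u hQ.last_mem
  have hQK : GPath G K o u Q := hQ.mono fun x hx => (hoff x (hQ.sub x hx)).1
  obtain ⟨j, hj, rfl⟩ := h.ear.path.exists_getElem hp
  have hnb : ∀ w ∈ W, G.Adj u w → w ∈ l ∨ w ∈ Q ∨ w ∈ R := by
    intro w hw huw
    by_contra! hcon
    refine hcon.2.1 (hN w (hK'.closed u huK w (Finset.mem_filter.2 ⟨?_, hcon.1, hcon.2.2⟩) huw) huw)
    exact h.comp.closed u (hoff u huK).1 w hw huw
  rcases hL with ⟨rfl, rfl⟩ | ⟨v₂, h1, h2, h3⟩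
  · exact ⟨y, u, Q, j, hu, (hoff u huK).1, hQK, fun x hx => (hoff x (hQ.sub x hx)).2.1, ⟨hj, hpy⟩, hnb⟩
  · refine ⟨y, u, L ++ Q, j, hu, (hoff u huK).1, h1.append hQK h2 fun x hx hx' =>
      (h3 x hx).2 (hQ.sub x hx'), fun x hx => ?_, ⟨hj, hpy⟩, fun w hw huw => ?_⟩
    · rcases List.mem_append.1 hx with hx | hx
      · exact (h3 x hx).1
      · exact (hoff x (hQ.sub x hx)).2.1
    · have := hnb w hw huw
      simp only [List.mem_append]
      tauto

theorem region_of_nonneg (h : LongEar G col c z W K a b l) (hK' : IsComp G (offEar K l R) K')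
    {p : V} (hp : p ∈ l) (ho : o ∈ K') (hpo : G.Adj p o) (hc : col o = false)
    (hb : 0 ≤ balance col K') : ∃ y u Q j, col u = true ∧ u ∈ K ∧ Region G W K l R y u Q j :=
  h.region_of_root hK' hp hpo (Or.inl ⟨rfl, rfl⟩) ho (Or.inl ⟨hc, hb⟩)

theorem region_of_pos (h : LongEar G col c z W K a b l) (hR : ∀ v ∈ R, col v = false)
    (hK' : IsComp G (offEar K l R) K') (hb : 1 ≤ balance col K') :
    ∃ y u Q j, col u = true ∧ u ∈ K ∧ Region G W K l R y u Q j := by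
  have hoff : ∀ x ∈ K', x ∈ K ∧ x ∉ l ∧ x ∉ R := fun x hx => Finset.mem_filter.1 (hK'.sub hx)
  obtain ⟨x, hx⟩ := hK'.nonempty
  obtain ⟨L, hL⟩ := h.comp.conn x (hoff x hx).1 a h.ends_mem.1
  obtain ⟨L₁, y, p, -, -, h1, h2, h3, h4⟩ := hL.exists_first (P := fun v => v ∈ l) (hoff x hx).2.1
    h.ear.path.head_mem
  by_cases hy : y ∈ K'
  · refine h.region_of_root hK' h3 h4.symm (Or.inl ⟨rfl, rfl⟩) hy ?_
    cases hc : col y <;> simp [hb]; omega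
  · obtain ⟨L₂, v₂, o, L₃, e, h5, h6, h7, h8⟩ := h1.reverse.exists_first (P := fun v => v ∈ K') hy hx
    have hv₂ : v₂ ∈ L₁ := by
      have : v₂ ∈ L₁.reverse := by rw [e]; exact List.mem_append_left _ h5.last_mem
      simpa using this
    have hvR : v₂ ∈ R := by
      by_contra hvR
      refine h6 v₂ h5.last_mem (hK'.closed o h7 v₂ (Finset.mem_filter.2 ⟨h1.sub v₂ hv₂, h2 v₂ hv₂, hvR⟩)
        h8.symm)
    refine h.region_of_root hK' h3 h4.symm (Or.inr ⟨v₂, h5, h8, fun x hx => ⟨h2 x ?_, h6 x hx⟩⟩) h7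
      (Or.inr ⟨?_, hb⟩)
    · have : x ∈ L₁.reverse := by rw [e]; exact List.mem_append_left _ hx
      simpa using this
    · rw [h.col_ne h8, hR v₂ hvR]; rfl

theorem not_region_of_small (h : LongEar G col c z W K a b l) (hv : v ∈ K) (hR : R ⊆ {v})
    (hc : col u ≠ col v) (hu : u ∈ K) (hreg : Region G W K l R o u Q j)
    (hs : cycleDegree G z v + outDegree G W v ≤ l.length / 2 + 1) : False := by
  obtain ⟨h1, l₀, l₁, h2, h3, h4⟩ := hreg.main h
  set N := (W.filter fun v => G.Adj u v) \ R with hN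
  have h5 := h.setup.pair u (h.comp.sub hu) v (h.comp.sub hv) hc
  have h6 : outDegree G W u ≤ N.card + if G.Adj u v then 1 else 0 := by
    have : (W.filter fun v => G.Adj u v) ⊆ N ∪ ((W.filter fun v => G.Adj u v) ∩ R) := by
      intro x hx
      by_cases hxR : x ∈ R
      · exact Finset.mem_union_right _ (Finset.mem_inter.2 ⟨hx, hxR⟩)
      · exact Finset.mem_union_left _ (Finset.mem_sdiff.2 ⟨hx, hxR⟩)
    refine (Finset.card_le_card this).trans ((Finset.card_union_le _ _).trans ?_)
    gcongr
    split_ifs with huv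
    · exact (Finset.card_le_card (Finset.inter_subset_right.trans hR)).trans (by simp)
    · rw [Nat.le_zero, Finset.card_eq_zero, Finset.eq_empty_iff_forall_notMem]
      intro x hx
      obtain ⟨hx, hxR⟩ := Finset.mem_inter.1 hx
      have := Finset.mem_singleton.1 (hR hxR)
      exact huv (this ▸ (Finset.mem_filter.1 hx).2)
  have h7 := h.length_lt
  by_cases hA : 2 ≤ cycleDegree G z u
  · obtain ⟨i, j, hi, hj, -⟩ := h.ear.att
    have hm : ∀ {x L}, GPath G K x u L → GPath G W u x L.reverse := fun hL =>
      hL.reverse.mono fun y hy => h.comp.sub (hL.sub y (by simpa using hy))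
    have h8 := h.setup.cyc.cycleDegree_add_length_le h.setup.out (hm h2) hi hA
    have h9 := h.setup.cyc.cycleDegree_add_length_le h.setup.out (hm h3) hj hA
    simp only [List.length_reverse] at h8 h9
    omega
  · omega

theorem not_exists_region (h : LongEar G col c z W K a b l) (hv : v ∈ K) (hR : R ⊆ {v})
    (hc : col v = false) (hs : cycleDegree G z v + outDegree G W v ≤ l.length / 2 + 1) :
    ¬ ∃ y u Q j, col u = true ∧ u ∈ K ∧ Region G W K l R y u Q j := by
  rintro ⟨y, u, Q, j, hu, huK, hreg⟩
  exact h.not_region_of_small hv hR (by simp [hu, hc]) huK hreg hs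

theorem balance_offEar (h : LongEar G col c z W K a b l) (hR : R ⊆ K) (hRl : ∀ v ∈ R, v ∉ l) :
    2 * balance col (offEar K l R) = 2 * balance col K - 2 * balance col R -
      ((if col a = true then 1 else -1) + (if col b = true then 1 else -1)) := by
  have h1 := balance_toFinset h.setup.cyc.bip h.ear.path
  have hl : l.toFinset ⊆ K := fun x hx => h.ear.path.sub x (by simpa using hx)
  have e : offEar K l R = (K \ l.toFinset) \ R := by
    ext x; simp [offEar, and_assoc]
  rw [e, balance_sdiff col fun x hx => Finset.mem_sdiff.2 ⟨hR hx, by simpa using hRl x hx⟩,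
    balance_sdiff col hl, ← h1]
  ring

/-- A component with at least as many vertices of colour `true` has no small vertex of colour
`false`. -/
theorem not_small_of_balance_nonneg (h : LongEar G col c z W K a b l) (hb : 0 ≤ balance col K)
    (hv : v ∈ K) (hc : col v = false)
    (hs : cycleDegree G z v + outDegree G W v ≤ l.length / 2 + 1) : False := by
  by_cases hab : col a = false ∧ col b = false
  · have hbal := h.balance_offEar (R := ∅) (by simp) (by simp)
    simp only [hab.1, hab.2, balance, Finset.filter_empty, Finset.card_empty] at hbal hb
    obtain ⟨K', hK', hb'⟩ := exists_comp_balance_pos (G := G) col (S := offEar K l ∅) (by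
      unfold balance; simp at hbal; omega)
    exact h.not_exists_region hv (R := ∅) (by simp) hc hs (h.region_of_pos (by simp) hK' hb')
  wlog ha : col a = true generalizing a b l
  · exact this h.reverse (by simpa using hs) (by tauto) (by
      cases h1 : col a <;> cases h2 : col b <;> simp_all)
  have hcl : ¬ Closed G W l a := fun hcl =>
    h.not_small_of_closed hcl (h.comp.sub hv) (by simp [hc, ha]) hs
  obtain ⟨w, hw, hwl, hws⟩ := h.reverse.exists_small (fun hcl' => hcl fun t ht hat => by
    simpa using hcl' t ht hat)
  simp only [List.mem_reverse, List.length_reverse] at hwl hws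
  have hlt := h.length_lt
  have hwc : col w = false := by
    by_contra hwc
    have := h.setup.pair w (h.comp.sub hw) v (h.comp.sub hv) (by simp [hc, hwc])
    omega
  have hbal := h.balance_offEar (R := {w}) (by simpa using hw) (by simpa using hwl)
  rw [balance_singleton, hwc, ha] at hbal
  have hnopos : ∀ K', IsComp G (offEar K l {w}) K' → balance col K' ≤ 0 := by
    intro K' hK'
    by_contra hpos
    exact h.not_exists_region hw subset_rfl hwc hws (h.region_of_pos (by simp [hwc]) hK' (by omega))
  obtain ⟨hb1, hb2⟩ := balance_le_of_comp col hnopos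
  have hbc : col b = true := by
    by_contra hbc
    simp only [hbc] at hbal
    simp at hbal
    omega
  simp [hbc] at hbal
  by_cases hy : ∃ y ∈ W, G.Adj a y ∧ y ∉ l ∧ y ≠ w
  · obtain ⟨y, hyW, hay, hyl, hyw⟩ := hy
    have hyK := h.comp.closed a h.ends_mem.1 y hyW hay
    have hy' : y ∈ offEar K l {w} := Finset.mem_filter.2 ⟨hyK, hyl, by simpa using hyw⟩
    have hcomp := isComp_compOf (G := G) hy'
    have := hb2 _ hcomp
    exact h.not_exists_region hw subset_rfl hwc hws (h.region_of_nonneg hcomp h.ear.path.head_mem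
      (mem_compOf_self hy') hay (by rw [h.col_ne hay, ha]; rfl) (by omega))
  push Not at hy
  have h1 := h.setup.pair a (h.comp.sub h.ends_mem.1) w (h.comp.sub hw) (by simp [ha, hwc])
  have h2 := h.two_mul_card_nbrs_le (u := a) (N := (W.filter fun t => G.Adj a t).erase w) fun t ht => by
    obtain ⟨h3, h4⟩ := Finset.mem_erase.1 ht
    obtain ⟨h4, h5⟩ := Finset.mem_filter.1 h4
    refine ⟨h5, ?_⟩
    by_contra htl
    exact h3 (hy t h4 h5 htl)
  rw [if_pos rfl, if_pos (by rw [hbc, ha])] at h2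
  have h3 : outDegree G W a ≤ ((W.filter fun t => G.Adj a t).erase w).card +
      if G.Adj a w then 1 else 0 := by
    unfold outDegree
    split_ifs with haw
    · have := Finset.pred_card_le_card_erase (s := W.filter fun t => G.Adj a t) (a := w)
      omega
    · rw [Finset.erase_eq_of_notMem (by simp [haw])]; omega
  obtain ⟨i, j, hi, hj, -⟩ := h.ear.att
  by_cases hA : 2 ≤ cycleDegree G z a
  · have h4 := h.setup.cyc.cycleDegree_add_length_le h.setup.out h.pathW hj hA
    omega
  · omega

theorem not_closed_of_balance_nonneg (h : LongEar G col c z W K a b l) (hb : 0 ≤ balance col K)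
    (hac : col a = false) (hbc : col b = false) (hacl : Closed G W l a) (hbcl : Closed G W l b) :
    False := by
  have hbal := h.balance_offEar (R := ∅) (by simp) (by simp)
  have h0 : balance col (∅ : Finset V) = 0 := by simp [balance]
  simp [hac, hbc, h0] at hbal
  obtain ⟨K', hK', hb'⟩ := exists_comp_balance_pos (G := G) col (S := offEar K l ∅) (by omega)
  obtain ⟨o, u, Q, k, hu, huK, hreg⟩ := h.region_of_pos (by simp) hK' hb'
  obtain ⟨h1, l₀, l₁, h2, h3, h4⟩ := hreg.main h
  rw [Finset.sdiff_empty] at h1 h4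
  change 2 * outDegree G W u ≤ _ at h1
  change 2 * outDegree G W u + _ + 1 ≤ _ at h4
  have h5 := h.setup.pair u (h.comp.sub huK) a (h.comp.sub h.ends_mem.1) (by simp [hu, hac])
  have h6 := h.setup.pair u (h.comp.sub huK) b (h.comp.sub h.ends_mem.2) (by simp [hu, hbc])
  have h7 := h.two_mul_outDegree_le hacl
  have h8 := h.two_mul_outDegree_le hbcl
  simp only [hac, hbc, if_true] at h7 h8
  obtain ⟨i, j, hi, hj, -⟩ := h.ear.att
  have hlt := h.length_lt
  by_cases hA : 1 ≤ cycleDegree G z u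
  · have hm : ∀ {x L}, GPath G K x u L → GPath G W x u L := fun hL =>
      hL.mono fun y hy => h.comp.sub (hL.sub y hy)
    have h9 := h.setup.cyc.cycleDegree_add_cycleDegree_add_length_le h.setup.out (hm h2)
      (by simp [hu, hac]) (h.setup.cyc.cycleDegree_pos hi) hA
    have h10 := h.setup.cyc.cycleDegree_add_cycleDegree_add_length_le h.setup.out (hm h3)
      (by simp [hu, hbc]) (h.setup.cyc.cycleDegree_pos hj) hA
    omega
  · by_cases hA' : 2 ≤ cycleDegree G z a
    · have h9 := h.setup.cyc.cycleDegree_add_length_le h.setup.out h.pathW hj hA'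
      omega
    · omega

/-- In a component with at least as many vertices of colour `true`, either some vertex of colour
`true` is small, or the ends of the longest ear have colour `true`, at least two neighbours on
the cycle, and no neighbours off the ear. -/
theorem small_or_closed (h : LongEar G col c z W K a b l) (hb : 0 ≤ balance col K) :
    (∃ v ∈ K, col v = true ∧ cycleDegree G z v + outDegree G W v ≤ l.length / 2 + 1) ∨
      (col a = true ∧ col b = true ∧ Closed G W l a ∧ Closed G W l b ∧ 2 ≤ cycleDegree G z a ∧
        2 ≤ cycleDegree G z b) := by
  have hsm : ∀ v ∈ K, cycleDegree G z v + outDegree G W v ≤ l.length / 2 + 1 →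
      ∃ v ∈ K, col v = true ∧ cycleDegree G z v + outDegree G W v ≤ l.length / 2 + 1 := by
    intro v hv hs
    refine ⟨v, hv, ?_, hs⟩
    by_contra hc
    exact h.not_small_of_balance_nonneg hb hv (by simpa using hc) hs
  by_contra! hcon
  have hno : ∀ v ∈ K, ¬ cycleDegree G z v + outDegree G W v ≤ l.length / 2 + 1 := by
    intro v hv hs
    obtain ⟨w, hw, h1, h2⟩ := hsm v hv hs
    have := hcon.1 w hw h1
    omega
  have hbcl : Closed G W l b := by
    by_contra hcl
    obtain ⟨v, hv, -, hs⟩ := h.exists_small hcl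
    exact hno v hv hs
  have hacl : Closed G W l a := by
    by_contra hcl
    obtain ⟨v, hv, -, hs⟩ := h.reverse.exists_small (fun hcl' => hcl fun t ht hat => by
      simpa using hcl' t ht hat)
    exact hno v hv (by simpa using hs)
  have hab := h.col_eq_of_closed hacl hbcl
  have hac : col a = true := by
    by_contra hac
    exact h.not_closed_of_balance_nonneg hb (by simpa using hac) (by rw [← hab]; simpa using hac)
      hacl hbcl
  have h7 := h.two_mul_outDegree_le hacl
  have h8 := h.two_mul_outDegree_le hbcl
  simp only [← hab, hac, if_true] at h7 h8
  have h9 := hno a h.ends_mem.1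
  have h10 := hno b h.ends_mem.2
  have := hcon.2 hac (by rw [← hab, hac]) hacl hbcl (by omega)
  omega

end LongEar

section Coupling
variable {V : Type*} [Fintype V] {G : SimpleGraph V} {col : V → Bool} {c : ℕ} {z : ℤ → V}
  {W K K' : Finset V} {a b a' b' v : V} {l l' : List V}

theorem IsComp.eq_or_disjoint (hK : IsComp G W K) (hK' : IsComp G W K') :
    K = K' ∨ ∀ x ∈ K, x ∉ K' := by
  by_cases hd : ∀ x ∈ K, x ∉ K'
  · exact Or.inr hd
  push Not at hd
  obtain ⟨x, hx, hx'⟩ := hd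
  have key : ∀ {K K' : Finset V}, IsComp G W K → IsComp G W K' → x ∈ K → x ∈ K' → K ⊆ K' := by
    intro K K' hK hK' hx hx' y hy
    obtain ⟨l, hl⟩ := hK.conn x hx y hy
    exact (hK'.gpath_sub (hl.mono fun t ht => hK.sub (hl.sub t ht)) hl.head_mem hx').sub y hl.last_mem
  exact Or.inl (Finset.Subset.antisymm (key hK hK' hx hx') (key hK' hK hx' hx))

namespace LongEar

theorem not_small_of_closed_of_disjoint (h : LongEar G col c z W K a b l)
    (h' : LongEar G col c z W K' a' b' l') (hd : ∀ x ∈ K, x ∉ K') (hab : col a = col b)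
    (ha : Closed G W l a) (hb : Closed G W l b) (hda : 2 ≤ cycleDegree G z a)
    (hdb : 2 ≤ cycleDegree G z b) (hv : v ∈ K') (hc : col v ≠ col a)
    (hs : cycleDegree G z v + outDegree G W v ≤ l'.length / 2 + 1) : False := by
  have h1 := h.setup.pair a (h.comp.sub h.ends_mem.1) v (h'.comp.sub hv) hc.symm
  have h2 := h.setup.pair b (h.comp.sub h.ends_mem.2) v (h'.comp.sub hv) (hab ▸ hc.symm)
  have h3 := h.two_mul_outDegree_le ha
  have h4 := h.two_mul_outDegree_le hb
  simp only [hab, if_true] at h3 h4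
  have hlt := h'.length_lt
  by_cases hlen : 2 ≤ l.length
  · have h5 := h.setup.cyc.cycleDegree_ends_le h.setup.out h.pathW hab hlen hda hdb
    omega
  · obtain ⟨i, j, hi, hj, hij⟩ := h'.ear.att
    have h5 := h.setup.cyc.cycleDegree_add_half_length_le h.setup.out h'.pathW
      (h.comp.sub h.ends_mem.1) (fun hal => hd a h.ends_mem.1 (h'.ear.path.sub a hal)) hi hj hij
    omega

end LongEar

theorem OutSetup.balance_ne_zero (h : OutSetup G col c z W) (hne : W.Nonempty) :
    balance col W ≠ 0 := by
  intro hbal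
  obtain ⟨K, hK, hb⟩ := exists_comp_balance_nonneg (G := G) col hbal.ge hne
  obtain ⟨K', hK', hb'⟩ := exists_comp_balance_nonneg (G := G) (fun v => !col v) (S := W)
    (by rw [balance_swap, hbal]; rfl) hne
  obtain ⟨a, b, l, hl⟩ := h.exists_longEar hK
  have hcert := hl.small_or_closed hb
  have hzero : ∀ (K : Finset V) a b l, LongEar G col c z W K a b l → balance col K ≠ 0 := by
    intro K a b l hl h0
    rcases hl.swap.small_or_closed (by rw [balance_swap, h0]; rfl) with ⟨v, hv, h1, h2⟩ | h1
    · rw [cycleDegree_shift] at h2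
      exact hl.not_small_of_balance_nonneg h0.ge hv (by simpa using h1) h2
    · rcases hl.small_or_closed h0.ge with ⟨v, hv, h3, h4⟩ | h3
      · exact hl.swap.not_small_of_balance_nonneg (by rw [balance_swap, h0]; rfl) hv (by simp [h3])
          (by simpa only [cycleDegree_shift] using h4)
      · simp [h3.1] at h1
  obtain ⟨a', b', l', hl'⟩ := h.exists_longEar hK'
  have hd : ∀ x ∈ K, x ∉ K' := by
    refine (hK.eq_or_disjoint hK').resolve_left ?_
    rintro rfl
    rw [balance_swap] at hb'
    exact hzero K a b l hl (by omega)
  have hd' : ∀ x ∈ K', x ∉ K := fun x hx hx' => hd x hx' hx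
  have hcert' := hl'.swap.small_or_closed hb'
  simp only [cycleDegree_shift, Bool.not_eq_true'] at hcert'
  rcases hcert with ⟨v, hv, h1, h2⟩ | ⟨h1, h2, h3, h4, h5, h6⟩ <;>
  rcases hcert' with ⟨w, hw, h1', h2'⟩ | ⟨h1', h2', h3', h4', h5', h6'⟩
  · have h3 := h.pair v (hK.sub hv) w (hK'.sub hw) (by simp [h1, h1'])
    have := hl.length_lt
    have := hl'.length_lt
    omega
  · exact hl'.not_small_of_closed_of_disjoint hl hd' (by rw [h1', h2']) h3' h4' h5' h6' hv
      (by simp [h1, h1']) h2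
  · exact hl.not_small_of_closed_of_disjoint hl' hd (by rw [h1, h2]) h3 h4 h5 h6 hw
      (by simp [h1, h1']) h2'
  · have hcnt := hl.ear.path.two_mul_countP h.cyc.bip true
    have hcnt' := hl'.ear.path.two_mul_countP h.cyc.bip true
    have d₀ := hl.two_mul_outDegree_le h3
    have d₁ := hl.two_mul_outDegree_le h4
    have d₀' := hl'.two_mul_outDegree_le h3'
    have d₁' := hl'.two_mul_outDegree_le h4'
    simp only [h1, h2, h1', h2', if_true] at hcnt hcnt' d₀ d₁ d₀' d₁'
    simp at hcnt'
    have hp : ∀ x ∈ K, ∀ y ∈ K', col x = true → col y = false → c + 2 ≤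
        cycleDegree G z x + outDegree G W x + (cycleDegree G z y + outDegree G W y) := by
      intro x hx y hy hxc hyc
      have := h.pair x (hK.sub hx) y (hK'.sub hy) (by simp [hxc, hyc])
      omega
    have p₀₀ := hp a hl.ends_mem.1 a' hl'.ends_mem.1 h1 h1'
    have p₀₁ := hp a hl.ends_mem.1 b' hl'.ends_mem.2 h1 h2'
    have p₁₀ := hp b hl.ends_mem.2 a' hl'.ends_mem.1 h2 h1'
    have p₁₁ := hp b hl.ends_mem.2 b' hl'.ends_mem.2 h2 h2'
    refine h.cyc.no_coupling h.out hl.pathW hl'.pathW (fun x hx hx' => hd x (hl.ear.path.sub x hx)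
      (hl'.ear.path.sub x hx')) (r := l.length / 2) (s := l'.length / 2) ?_ ?_ h1 h1' ?_ ?_ ?_ ?_
      h5 h6 h5' h6' <;> omega

end Coupling

/-- The number of edges of the two-coloured graph `G` with an end in `W`. -/
def touchCount {V : Type*} [Fintype V] (G : SimpleGraph V) (col : V → Bool) (W : Finset V) : ℕ :=
  (Finset.univ.filter fun p : V × V => col p.1 = true ∧ G.Adj p.1 p.2 ∧ (p.1 ∈ W ∨ p.2 ∈ W)).card

/-- The graph `G` with all edges at vertices of `U` deleted. -/
def deleteTouching {V : Type*} (G : SimpleGraph V) (U : Finset V) : SimpleGraph V where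
  Adj x y := G.Adj x y ∧ x ∉ U ∧ y ∉ U
  symm := ⟨fun _ _ h => ⟨h.1.symm, h.2.2, h.2.1⟩⟩
  loopless := ⟨fun _ h => h.1.ne rfl⟩

section EdgeCount
variable {V : Type*} [Fintype V] {G : SimpleGraph V} {col : V → Bool} {c : ℕ} {z : ℤ → V}
  {W U : Finset V} {u v : V}

theorem touchCount_swap (bip : ∀ u v, G.Adj u v → col u ≠ col v) :
    touchCount G (fun v => !col v) W = touchCount G col W := by
  refine Finset.card_bij (fun p _ => (p.2, p.1)) ?_ ?_ ?_
  · rintro ⟨x, y⟩ hp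
    simp only [Finset.mem_filter, Finset.mem_univ, true_and] at hp ⊢
    have := bip _ _ hp.2.1
    refine ⟨?_, hp.2.1.symm, hp.2.2.symm⟩
    cases h1 : col x <;> cases h2 : col y <;> simp_all
  · rintro ⟨x, y⟩ - ⟨x', y'⟩ - h
    simpa [and_comm] using h
  · rintro ⟨x, y⟩ hp
    simp only [Finset.mem_filter, Finset.mem_univ, true_and] at hp
    have := bip _ _ hp.2.1
    refine ⟨(y, x), ?_, rfl⟩
    simp only [Finset.mem_filter, Finset.mem_univ, true_and]
    refine ⟨?_, hp.2.1.symm, hp.2.2.symm⟩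
    cases h1 : col x <;> cases h2 : col y <;> simp_all

theorem touchCount_le_delete :
    touchCount G col W ≤ touchCount (deleteTouching G U) col (W \ U) + touchCount G col U := by
  refine (Finset.card_le_card ?_).trans (Finset.card_union_le _ _)
  intro p hp
  simp only [Finset.mem_union, Finset.mem_filter, Finset.mem_univ, true_and, deleteTouching,
    Finset.mem_sdiff] at hp ⊢
  tauto

theorem CycleSetup.delete (h : CycleSetup G col c z) (hU : ∀ w ∈ U, ∀ i, w ≠ z i) :
    CycleSetup (deleteTouching G U) col c z where
  bip u v huv := h.bip u v huv.1
  two_le := h.two_le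
  adj i := ⟨h.adj i, fun hi => hU _ hi i rfl, fun hi => hU _ hi (i + 1) rfl⟩
  inj := h.inj
  col_even := h.col_even
  max l a b h1 h2 h3 h4 h5 h6 := h.max l a b (h1.imp fun _ _ h => h.1) h2 h3 h4 h5.1 h6

theorem card_nbrs_le (hclosed : ∀ w ∈ W, ∀ v, G.Adj w v → v ∈ W ∨ ∃ i, v = z i) (hu : u ∈ W) :
    (Finset.univ.filter fun v => G.Adj u v).card ≤ cycleDegree G z u + outDegree G W u := by
  refine (Finset.card_le_card ?_).trans (Finset.card_union_le _ _)
  intro v hv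
  have hv := (Finset.mem_filter.1 hv).2
  rcases hclosed u hu v hv with h | h <;> simp [hv, h]

theorem touchCount_singleton_le (hclosed : ∀ w ∈ W, ∀ v, G.Adj w v → v ∈ W ∨ ∃ i, v = z i)
    (bip : ∀ u v, G.Adj u v → col u ≠ col v) (hu : u ∈ W) (hc : col u = true) :
    touchCount G col {u} ≤ cycleDegree G z u + outDegree G W u := by
  refine le_trans (Finset.card_le_card_of_injOn Prod.snd ?_ ?_) (card_nbrs_le hclosed hu)
  · rintro ⟨x, y⟩ hp
    simp only [Finset.coe_filter, Finset.mem_univ, true_and, Set.mem_ofPred_eq, Finset.mem_singleton]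
      at hp ⊢
    have := bip _ _ hp.2.1
    rcases hp.2.2 with rfl | rfl
    · exact hp.2.1
    · simp_all
  · rintro ⟨x, y⟩ hp ⟨x', y'⟩ hp' (rfl : y = y')
    simp only [Finset.coe_filter, Finset.mem_univ, true_and, Set.mem_ofPred_eq, Finset.mem_singleton]
      at hp hp'
    have := bip _ _ hp.2.1
    have := bip _ _ hp'.2.1
    rcases hp.2.2 with rfl | rfl <;> rcases hp'.2.2 with h1 | h1 <;> simp_all

theorem touchCount_pair_le (hclosed : ∀ w ∈ W, ∀ v, G.Adj w v → v ∈ W ∨ ∃ i, v = z i)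
    (bip : ∀ u v, G.Adj u v → col u ≠ col v) (hu : u ∈ W) (hv : v ∈ W) (hc : col u ≠ col v) :
    touchCount G col {u, v} + (if G.Adj u v then 1 else 0) ≤
      cycleDegree G z u + outDegree G W u + (cycleDegree G z v + outDegree G W v) := by
  wlog h : col u = true generalizing u v
  · have := this hv hu hc.symm (by cases h1 : col u <;> cases h2 : col v <;> simp_all)
    rw [Finset.pair_comm, G.adj_comm v u] at this
    omega
  have hcv : col v = false := by cases h2 : col v <;> simp_all
  refine le_trans ?_ (Nat.add_le_add (card_nbrs_le hclosed hu) (card_nbrs_le hclosed hv))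
  set A := (Finset.univ.filter fun x => G.Adj u x).image fun x => (u, x) with hA
  set B := (Finset.univ.filter fun x => G.Adj v x).image fun x => (x, v) with hB
  have hAc : A.card = (Finset.univ.filter fun x => G.Adj u x).card :=
    Finset.card_image_of_injective _ fun x y h => by simpa using h
  have hBc : B.card = (Finset.univ.filter fun x => G.Adj v x).card :=
    Finset.card_image_of_injective _ fun x y h => by simpa using h
  rw [← hAc, ← hBc, ← Finset.card_union_add_card_inter]
  gcongr
  · refine Finset.card_le_card ?_
    rintro ⟨x, y⟩ hp
    simp only [Finset.mem_filter, Finset.mem_univ, true_and, Finset.mem_insert, Finset.mem_singleton]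
      at hp
    have := bip _ _ hp.2.1
    rcases hp.2.2 with (rfl | rfl) | (rfl | rfl)
    · exact Finset.mem_union_left _ (Finset.mem_image.2 ⟨y, by simpa using hp.2.1, rfl⟩)
    · simp_all
    · simp_all
    · exact Finset.mem_union_right _ (Finset.mem_image.2 ⟨x, by simpa using hp.2.1.symm, rfl⟩)
  · split_ifs with huv
    · exact Finset.card_pos.2 ⟨(u, v), Finset.mem_inter.2
        ⟨Finset.mem_image.2 ⟨v, by simpa using huv, rfl⟩,
          Finset.mem_image.2 ⟨u, by simpa using huv.symm, rfl⟩⟩⟩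
    · exact Nat.zero_le _

theorem touchCount_le_of_separated (bip : ∀ u v, G.Adj u v → col u ≠ col v) {x : V}
    (hU : ∀ w ∈ U, ∀ v, G.Adj w v → v ∈ U ∨ v = x) :
    touchCount G col U ≤ ((U.filter fun v => col v = true).card + 1) *
        (U.filter fun v => col v = false).card ∨
      touchCount G col U ≤ (U.filter fun v => col v = true).card *
        ((U.filter fun v => col v = false).card + 1) := by
  cases hc : col x
  · right
    refine le_trans (Finset.card_le_card (t := (U.filter fun v => col v = true) ×ˢ
      (insert x (U.filter fun v => col v = false))) ?_) (by
        rw [Finset.card_product]; gcongr; exact Finset.card_insert_le _ _)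
    rintro ⟨p, q⟩ hp
    simp only [Finset.mem_filter, Finset.mem_univ, true_and, Finset.mem_product, Finset.mem_insert]
      at hp ⊢
    have h1 := bip _ _ hp.2.1
    have h2 := hU p
    have h3 := hU q
    have hq : col q = false := by cases h : col q <;> simp_all
    rcases hp.2.2 with h | h
    · have := h2 h q hp.2.1
      tauto
    · have := h3 h p hp.2.1.symm
      rcases this with h4 | rfl
      · tauto
      · simp_all
  · left
    refine le_trans (Finset.card_le_card (t := (insert x (U.filter fun v => col v = true)) ×ˢ
      (U.filter fun v => col v = false)) ?_) (by
        rw [Finset.card_product]; gcongr; exact Finset.card_insert_le _ _)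
    rintro ⟨p, q⟩ hp
    simp only [Finset.mem_filter, Finset.mem_univ, true_and, Finset.mem_product, Finset.mem_insert]
      at hp ⊢
    have h1 := bip _ _ hp.2.1
    have h2 := hU p
    have h3 := hU q
    have hq : col q = false := by cases h : col q <;> simp_all
    rcases hp.2.2 with h | h
    · have := h2 h q hp.2.1
      rcases this with h4 | rfl
      · tauto
      · simp_all
    · have := h3 h p hp.2.1.symm
      tauto

/-- If `W` has more vertices of colour `true` than of colour `false`, and at most `c` of the latter,
then it has a vertex of colour `true` and degree at most `c`. -/
theorem CycleSetup.exists_degree_le (h : CycleSetup G col c z) (hout : ∀ w ∈ W, ∀ i, w ≠ z i)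
    (hy : (W.filter fun v => col v = false).card ≤ c)
    (hxy : (W.filter fun v => col v = false).card < (W.filter fun v => col v = true).card) :
    ∃ u ∈ W, col u = true ∧ cycleDegree G z u + outDegree G W u ≤ c := by
  by_cases h0 : ∃ u ∈ W, col u = true ∧ cycleDegree G z u = 0
  · obtain ⟨u, hu, hc, hd⟩ := h0
    refine ⟨u, hu, hc, ?_⟩
    rw [hd, zero_add]
    refine le_trans (Finset.card_le_card fun v hv => ?_) hy
    obtain ⟨hv, huv⟩ := Finset.mem_filter.1 hv
    have := h.bip _ _ huv
    refine Finset.mem_filter.2 ⟨hv, ?_⟩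
    cases h2 : col v <;> simp_all
  push Not at h0
  obtain ⟨K, hK, hb⟩ := exists_comp_balance_pos (G := G) col (S := W) (by unfold balance; omega)
  obtain ⟨o, ho⟩ : ((K.filter fun v => col v = true)).Nonempty := by
    rw [← Finset.card_pos]
    unfold balance at hb
    omega
  obtain ⟨hoK, hoc⟩ := Finset.mem_filter.1 ho
  obtain ⟨u, Q, hu, hQ, hN⟩ := exists_path_containing_neighbors h.bip hK.conn hoK (Or.inr ⟨hoc, hb⟩)
  have huK := hQ.sub u hQ.last_mem
  have hQW : GPath G W o u Q := hQ.mono fun x hx => hK.sub (hQ.sub x hx)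
  refine ⟨u, hK.sub huK, hu, ?_⟩
  have h1 := hQ.two_mul_card_le h.bip (N := W.filter fun t => G.Adj u t) (κ := false) fun t ht => by
    obtain ⟨ht, hut⟩ := Finset.mem_filter.1 ht
    have := h.bip _ _ hut
    exact ⟨hN t (hK.closed u huK t ht hut) hut, by cases h2 : col t <;> simp_all⟩
  simp only [hoc, hu, Bool.true_eq_false, if_false] at h1
  change 2 * outDegree G W u + 1 ≤ _ at h1
  obtain ⟨i, hi⟩ := CycleSetup.exists_adj_of_cycleDegree_pos (G := G) (z := z) o
    (Nat.one_le_iff_ne_zero.2 (h0 o (hK.sub hoK) hoc))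
  obtain ⟨j, hj⟩ := CycleSetup.exists_adj_of_cycleDegree_pos (G := G) (z := z) u
    (Nat.one_le_iff_ne_zero.2 (h0 u (hK.sub huK) hu))
  have htwo := h.two_le
  by_cases hd : 2 ≤ cycleDegree G z u
  · have := h.cycleDegree_add_length_le hout hQW.reverse hi hd
    rw [List.length_reverse] at this
    omega
  · by_cases hlen : 2 ≤ Q.length
    · by_cases hij : z i = z j
      · rw [← hij] at hj
        have := h.length_add_one_le hout hQW hi hj hlen
        omega
      · have := h.length_ear_lt hout hQW hi hj hij
        omega
    · omega

theorem card_filter_sdiff_add (S : Finset V) (hU : U ⊆ S) (κ : Bool) :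
    ((S \ U).filter fun v => col v = κ).card + (U.filter fun v => col v = κ).card =
      (S.filter fun v => col v = κ).card := by
  rw [← Finset.card_union_of_disjoint (Finset.disjoint_filter_filter Finset.sdiff_disjoint),
    ← Finset.filter_union, Finset.sdiff_union_of_subset hU]

theorem card_filter_pair {u v : V} (huv : col u ≠ col v) (κ : Bool) :
    (({u, v} : Finset V).filter fun w => col w = κ).card = 1 := by
  have hne : u ≠ v := fun h => huv (h ▸ rfl)
  rw [Finset.filter_insert, Finset.filter_singleton]
  by_cases hu : col u = κ
  · rw [if_pos hu, if_neg (hu ▸ huv.symm)]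
    rfl
  · have hv : col v = κ := by
      revert huv hu
      cases col u <;> cases col v <;> cases κ <;> simp
    rw [if_neg hu, if_pos hv, Finset.card_singleton]

/-- The edge bound, for the graph `G` with a longest cycle `z` and a set `W` off this cycle. -/
theorem touchCount_le_of_cycleSetup (h : CycleSetup G col c z) (hout : ∀ w ∈ W, ∀ i, w ≠ z i)
    (hclosed : ∀ w ∈ W, ∀ v, G.Adj w v → v ∈ W ∨ ∃ i, v = z i)
    (hmin : min (W.filter fun v => col v = true).card (W.filter fun v => col v = false).card ≤ c) :
    touchCount G col W ≤
      c * max (W.filter fun v => col v = true).card (W.filter fun v => col v = false).card +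
        min (W.filter fun v => col v = true).card (W.filter fun v => col v = false).card := by
  induction' hn : W.card using Nat.strong_induction_on with n ih generalizing W G col z
  wlog hxy : (W.filter fun v => col v = false).card ≤ (W.filter fun v => col v = true).card
    generalizing col z
  · have := this h.swap (fun w hw i => hout w hw (i + 1)) (fun w hw v hv => (hclosed w hw v hv).imp id
      fun ⟨i, hi⟩ => ⟨i - 1, by rw [hi]; congr 1; ring⟩) (by
        simp only [Bool.not_eq_true', Bool.not_eq_false']; rwa [min_comm])
        (by simp only [Bool.not_eq_true', Bool.not_eq_false']; omega)
    rw [touchCount_swap h.bip] at this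
    simp only [Bool.not_eq_true', Bool.not_eq_false'] at this
    rwa [max_comm, min_comm]
  have hdel : ∀ U ⊆ W, U.Nonempty →
      min ((W \ U).filter fun v => col v = true).card ((W \ U).filter fun v => col v = false).card ≤ c →
      touchCount G col W ≤
        c * max ((W \ U).filter fun v => col v = true).card ((W \ U).filter fun v => col v = false).card +
          min ((W \ U).filter fun v => col v = true).card ((W \ U).filter fun v => col v = false).card +
            touchCount G col U := by
    intro U hU hne hle
    refine touchCount_le_delete.trans (Nat.add_le_add_right ?_ _)
    refine ih _ (hn ▸ Finset.card_lt_card (Finset.sdiff_ssubset hU hne))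
      (h.delete fun w hw => hout w (hU hw)) (fun w hw => hout w (Finset.mem_sdiff.1 hw).1)
      (fun w hw v hv => ?_) hle rfl
    exact (hclosed w (Finset.mem_sdiff.1 hw).1 v hv.1).imp (fun h => Finset.mem_sdiff.2 ⟨h, hv.2.2⟩) id
  rcases hxy.lt_or_eq with hlt | heq
  · obtain ⟨u, hu, hc, hd⟩ := h.exists_degree_le hout (by omega) hlt
    have hU : {u} ⊆ W := by simpa using hu
    have h1 := card_filter_sdiff_add (col := col) W hU true
    have h2 := card_filter_sdiff_add (col := col) W hU false
    have h3 : (Finset.filter (fun v => col v = true) {u}).card = 1 := by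
      rw [Finset.filter_singleton, if_pos hc, Finset.card_singleton]
    have h4 : (Finset.filter (fun v => col v = false) {u}).card = 0 := by
      rw [Finset.filter_singleton, if_neg (by simp [hc]), Finset.card_empty]
    have h5 := hdel {u} hU (Finset.singleton_nonempty u) (by omega)
    have h6 := touchCount_singleton_le hclosed h.bip hu hc
    rw [h3] at h1
    rw [h4] at h2
    rw [max_eq_left (by omega), min_eq_right (by omega)] at h5 ⊢
    rw [← h1, ← h2, mul_add]
    omega
  · rw [heq, min_self] at hmin
    rw [heq, max_self, min_self]
    rcases W.eq_empty_or_nonempty with rfl | hne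
    · simp [touchCount]
    by_contra! hcon
    set m := (W.filter fun v => col v = true).card with hm
    have hsetup : OutSetup G col c z W := by
      refine ⟨h, hout, hclosed, fun u hu v hv huv => ?_, fun U hU hUne x => ?_⟩
      · have hU : {u, v} ⊆ W := by
          intro x hx
          rcases Finset.mem_insert.1 hx with rfl | hx
          · exact hu
          · rwa [Finset.mem_singleton.1 hx]
        have h1 := card_filter_sdiff_add (col := col) W hU true
        have h2 := card_filter_sdiff_add (col := col) W hU false
        have h3 := card_filter_pair huv true
        have h4 := card_filter_pair huv false
        have h5 := hdel {u, v} hU ⟨u, by simp⟩ (by omega)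
        have h6 := touchCount_pair_le hclosed h.bip hu hv huv
        rw [max_eq_left (by omega), min_eq_left (by omega)] at h5
        rw [h3, ← hm] at h1
        rw [← h1, mul_add] at hcon
        omega
      · by_contra! hcut
        have h1 := card_filter_sdiff_add (col := col) W hU true
        have h2 := card_filter_sdiff_add (col := col) W hU false
        have h5 := hdel U hU hUne (by omega)
        have h6 := touchCount_le_of_separated h.bip (U := U) (x := x) fun w hw v hv => by
          by_contra! hvx
          exact hcut w hw v hvx.1 hvx.2 hv
        rw [heq] at h2
        rw [← hm] at h1
        generalize (U.filter fun v => col v = true).card = p at *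
        generalize (U.filter fun v => col v = false).card = q at *
        generalize ((W \ U).filter fun v => col v = true).card = p' at *
        generalize ((W \ U).filter fun v => col v = false).card = q' at *
        clear_value m
        have hp : p ≤ c := by omega
        have hq : q ≤ c := by omega
        rcases le_total p q with hpq | hpq
        · rw [max_eq_left (by omega), min_eq_right (by omega)] at h5
          rcases h6 with h6 | h6 <;> nlinarith
        · rw [max_eq_right (by omega), min_eq_left (by omega)] at h5
          rcases h6 with h6 | h6 <;> nlinarith
    refine hsetup.balance_ne_zero hne ?_
    unfold balance
    omega

end EdgeCount

section Transfer
variable {V : Type*} {G : SimpleGraph V} {col : V → Bool} {c : ℕ} {z : ℤ → V} {W : Finset V}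

theorem exists_isCycle_of_isChain {l : List V} {a b : V} (hl : l.IsChain G.Adj) (hnd : l.Nodup)
    (ha : l.head? = some a) (hb : l.getLast? = some b) (hba : G.Adj b a) (h3 : 3 ≤ l.length) :
    ∃ q : G.Walk b b, q.IsCycle ∧ q.length = l.length := by
  have hne : l ≠ [] := by rintro rfl; simp at h3
  obtain ⟨p, hp⟩ : ∃ p : G.Walk a b, p.support = l := by
    have h1 : l.head hne = a := by simpa [List.head?_eq_some_head hne] using ha
    have h2 : l.getLast hne = b := by simpa [List.getLast?_eq_some_getLast hne] using hb
    subst h1 h2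
    exact ⟨.ofSupport l hne hl, by simp⟩
  have hlen : p.length + 1 = l.length := by rw [← hp, SimpleGraph.Walk.length_support]
  have hpath : p.IsPath := .mk' (hp ▸ hnd)
  refine ⟨.cons hba p, (SimpleGraph.Walk.cons_isCycle_iff p hba).2 ⟨hpath, fun hmem => ?_⟩, by simpa⟩
  have h1 := hpath.length_eq_one_of_mem_edges (Sym2.eq_swap ▸ hmem)
  omega

theorem CycleSetup.of_isCycle (bip : ∀ u v, G.Adj u v → col u ≠ col v) {v : V} (p : G.Walk v v)
    (hp : p.IsCycle) (hlen : p.length = 2 * c)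
    (hmax : ∀ (u : V) (q : G.Walk u u), q.IsCycle → q.length ≤ 2 * c) :
    ∃ z, CycleSetup G col c z ∧ ∀ w, w ∈ p.support ↔ ∃ i, w = z i := by
  have hc := hp.three_le_length
  set y : ℤ → V := fun i => p.getVert (i % (2 * c : ℤ)).toNat with hy
  have hbd (i : ℤ) : 0 ≤ i % (2 * c : ℤ) ∧ i % (2 * c : ℤ) < 2 * c :=
    ⟨Int.emod_nonneg _ (by omega), Int.emod_lt_of_pos _ (by omega)⟩
  have hadj (i : ℤ) : G.Adj (y i) (y (i + 1)) := by
    have h1 := p.adj_getVert_succ (i := (i % (2 * c : ℤ)).toNat) (by have := hbd i; omega)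
    convert h1 using 1
    have h2 := Int.emod_add_emod i (2 * c) 1
    simp only [hy]
    rw [← h2]
    have h3 := hbd i
    rcases (show i % (2 * c : ℤ) + 1 ≤ 2 * c by omega).lt_or_eq with h4 | h4
    · rw [Int.emod_eq_of_lt (by omega) h4]
      congr 1
      omega
    · rw [h4, Int.emod_self, show (i % (2 * c : ℤ)).toNat + 1 = p.length by omega,
        p.getVert_length]
      simp
  have hinj (i j : ℤ) : y i = y j ↔ (2 * c : ℤ) ∣ i - j := by
    rw [← Int.emod_eq_emod_iff_emod_sub_eq_zero.trans Int.dvd_iff_emod_eq_zero.symm]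
    refine ⟨fun h => ?_, fun h => by simp only [hy, h]⟩
    have h1 := hbd i
    have h2 := hbd j
    have := hp.getVert_injOn' (by simp; omega) (by simp; omega) h
    omega
  have hcol (i : ℤ) : col (y (i + 1)) = !col (y i) := by
    have := bip _ _ (hadj i)
    revert this
    cases col (y i) <;> cases col (y (i + 1)) <;> simp
  have hcol2 (s i : ℤ) : col (y (2 * i + s)) = col (y s) := by
    induction i using Int.induction_on with
    | zero => simp
    | succ i ih =>
      rw [← ih, show 2 * ((i : ℤ) + 1) + s = 2 * i + s + 1 + 1 by ring, hcol, hcol, Bool.not_not]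
    | pred i ih =>
      rw [← ih, show 2 * (-(i : ℤ)) + s = 2 * (-i - 1) + s + 1 + 1 by ring, hcol, hcol, Bool.not_not]
  obtain ⟨s, hs⟩ : ∃ s, col (y s) = true := by
    by_cases h : col (y 0) = true
    · exact ⟨0, h⟩
    · exact ⟨0 + 1, by rw [hcol]; simpa using h⟩
  refine ⟨fun i => y (i + s), ⟨bip, by omega, fun i => ?_, fun i j => ?_, fun i => ?_, ?_⟩, fun w => ?_⟩
  · rw [add_right_comm]
    exact hadj _
  · rw [hinj, add_sub_add_right_eq_sub]
  · rw [hcol2, hs]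
  · intro l a b hl hnd ha hb hba h3
    obtain ⟨q, hq, hql⟩ := exists_isCycle_of_isChain hl hnd ha hb hba h3
    exact hql ▸ hmax _ q hq
  · rw [SimpleGraph.Walk.mem_support_iff_exists_getVert]
    constructor
    · rintro ⟨k, rfl, hk⟩
      refine ⟨k - s, ?_⟩
      change _ = y (k - s + s)
      rw [sub_add_cancel]
      rcases hk.lt_or_eq with hk | rfl
      · simp only [hy]
        rw [Int.emod_eq_of_lt (by omega) (by omega), Int.toNat_natCast]
      · simp only [hy]
        rw [p.getVert_length, hlen, Nat.cast_mul, Nat.cast_two, Int.emod_self, Int.toNat_zero,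
          p.getVert_zero]
    · rintro ⟨i, rfl⟩
      exact ⟨_, rfl, by have := hbd (i + s); omega⟩

theorem CycleSetup.card_filter_eq [Fintype V] (h : CycleSetup G col c z) (κ : Bool) :
    (Finset.univ.filter fun v => (∃ i, v = z i) ∧ col v = κ).card = c := by
  wlog hκ : κ = true generalizing col z κ
  · rw [Bool.not_eq_true] at hκ
    rw [← this h.swap true rfl]
    congr 1
    ext v
    have : (∃ i, v = z i) ↔ ∃ i, v = z (i + 1) :=
      ⟨fun ⟨i, hi⟩ => ⟨i - 1, by simpa using hi⟩, fun ⟨i, hi⟩ => ⟨i + 1, hi⟩⟩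
    simp [hκ, this]
  have h2 := h.two_le
  rw [← Finset.card_range c]
  symm
  refine Finset.card_bij (fun i _ => z (2 * i)) (fun i _ => ?_) (fun i hi j hj hij => ?_)
    fun v hv => ?_
  · simp [hκ, h.col_even]
  · rw [h.inj, ← mul_sub] at hij
    have := Int.dvd_of_mul_dvd_mul_left (by norm_num) hij
    rw [Finset.mem_range] at hi hj
    have := Int.eq_zero_of_abs_lt_dvd this (by rw [abs_lt]; omega)
    omega
  · obtain ⟨⟨k, rfl⟩, hk⟩ := (Finset.mem_filter.1 hv).2
    obtain ⟨j, rfl | rfl⟩ := Int.even_or_odd' k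
    · have h3 := Int.emod_nonneg j (b := c) (by omega)
      have h4 := Int.emod_lt_of_pos j (b := c) (by omega)
      refine ⟨(j % c).toNat, Finset.mem_range.2 (by omega), ?_⟩
      rw [h.inj, ← mul_sub, Int.toNat_of_nonneg h3]
      exact mul_dvd_mul_left _ (Int.dvd_sub_self_of_emod_eq rfl)
    · rw [h.col_odd, hκ] at hk
      cases hk

theorem ncard_edges_le_touchCount [Fintype V] (bip : ∀ u v, G.Adj u v → col u ≠ col v) :
    Set.ncard {e : Sym2 V | e ∈ G.edgeSet ∧ ∃ w ∈ e, w ∈ W} ≤ touchCount G col W := by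
  rw [touchCount, ← Set.ncard_coe_finset]
  refine (Set.ncard_le_ncard ?_ ((Finset.finite_toSet _).image fun p : V × V => s(p.1, p.2))).trans
    (Set.ncard_image_le (Finset.finite_toSet _))
  intro e
  induction e using Sym2.ind with
  | _ x y =>
    rintro ⟨hxy, w, hw, hwW⟩
    rw [SimpleGraph.mem_edgeSet] at hxy
    have hW : x ∈ W ∨ y ∈ W := by
      rcases Sym2.mem_iff.1 hw with rfl | rfl
      exacts [Or.inl hwW, Or.inr hwW]
    by_cases hx : col x = true
    · exact ⟨(x, y), by simp [hx, hxy, hW], rfl⟩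
    · have hy : col y = true := by
        have := bip _ _ hxy
        revert this hx
        cases col x <;> cases col y <;> simp
      exact ⟨(y, x), by simp [hy, hxy.symm, hW.symm], Sym2.eq_swap⟩

theorem card_filter_isLeft (n m : ℕ) (κ : Bool) :
    (Finset.univ.filter fun v : Fin n ⊕ Fin m => v.isLeft = κ).card = if κ then n else m := by
  rw [Finset.card_filter, Fintype.sum_sum_type]
  cases κ <;> simp

theorem ncard_edges_le_of_isCycle (n m c : ℕ) (hmn : m ≤ n)
    (G : SimpleGraph (Fin n ⊕ Fin m))
    (hG : G ≤ completeBipartiteGraph (Fin n) (Fin m))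
    (v : Fin n ⊕ Fin m) (p : G.Walk v v) (hp : p.IsCycle) (hplen : p.length = 2 * c)
    (hmax : ∀ u (q : G.Walk u u), q.IsCycle → q.length ≤ 2 * c)
    (hcm : c ≤ m) (hm2c : m ≤ 2 * c) :
    Set.ncard {e : Sym2 (Fin n ⊕ Fin m) | e ∈ G.edgeSet ∧ ¬ ∀ w ∈ e, w ∈ p.support} ≤
      c * (n - 1 - c) + m := by
  have bip (x y) (h : G.Adj x y) : x.isLeft ≠ y.isLeft := by
    have := hG h
    cases x <;> cases y <;> simp_all
  obtain ⟨z, hz, hsupp⟩ :=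
    CycleSetup.of_isCycle bip p hp hplen hmax
  set W := Finset.univ.filter (· ∉ p.support) with hW
  have hcard (κ : Bool) : (W.filter fun v => v.isLeft = κ).card + c = if κ then n else m := by
    have h1 := Finset.card_filter_add_card_filter_not
      (s := Finset.univ.filter fun v : Fin n ⊕ Fin m => v.isLeft = κ) (fun v => ∃ i, v = z i)
    have h2 := hz.card_filter_eq κ
    rw [card_filter_isLeft, Finset.filter_filter, Finset.filter_filter] at h1
    rw [hW, Finset.filter_filter]
    simp only [hsupp]
    simp only [and_comm] at h1 h2 ⊢
    omega
  have h1 := hcard true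
  have h2 := hcard false
  simp only [if_true, Bool.false_eq_true, if_false] at h1 h2
  have hset : {e : Sym2 (Fin n ⊕ Fin m) | e ∈ G.edgeSet ∧ ¬ ∀ w ∈ e, w ∈ p.support} =
      {e | e ∈ G.edgeSet ∧ ∃ w ∈ e, w ∈ W} := by
    simp only [not_forall, exists_prop, hW, Finset.mem_filter, Finset.mem_univ, true_and]
  rw [hset]
  refine (ncard_edges_le_touchCount bip).trans ((touchCount_le_of_cycleSetup hz ?_ ?_ ?_).trans ?_)
  · intro w hw i hi
    exact (Finset.mem_filter.1 hw).2 ((hsupp w).2 ⟨i, hi⟩)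
  · intro w _ v _
    rw [← hsupp, hW, Finset.mem_filter]
    simpa using (em _).symm
  · omega
  · rw [max_eq_left (by omega), min_eq_right (by omega)]
    rcases (show c ≤ n by omega).eq_or_lt with rfl | hlt
    · rw [show (W.filter fun v => v.isLeft = true).card = 0 by omega]
      omega
    · rw [show (W.filter fun v => v.isLeft = true).card = n - 1 - c + 1 by omega]
      rw [mul_add]
      omega

end Transfer

end LongestCycle

/-- (Li–Ning) Let `G` be bipartite with parts of sizes `n ≥ m`, and `C` (given by the
closed walk `p`) a longest cycle with `2c` vertices, `c ≤ m`. If `m ≤ 2c`, then the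
number of edges with at least one endpoint outside `C` satisfies
`e(G - C) + e(G - C, C) ≤ c(n - 1 - c) + m`. -/
theorem li_ning_small (n m c : ℕ) (hmn : m ≤ n)
    (G : SimpleGraph (Fin n ⊕ Fin m))
    (hG : G ≤ completeBipartiteGraph (Fin n) (Fin m))
    (v : Fin n ⊕ Fin m) (p : G.Walk v v) (hp : p.IsCycle) (hplen : p.length = 2 * c)
    (hmax : ∀ l : ℕ, hasCycleLength G l → l ≤ 2 * c)
    (hcm : c ≤ m) (hm2c : m ≤ 2 * c) :
    Set.ncard {e : Sym2 (Fin n ⊕ Fin m) | e ∈ G.edgeSet ∧ ¬ ∀ w ∈ e, w ∈ p.support} ≤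
      c * (n - 1 - c) + m := by
  exact ncard_edges_le_of_isCycle n m c hmn G hG v p hp hplen (fun u q hq => hmax _ ⟨u, q, hq, rfl⟩)
    hcm hm2c
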